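/- arXiv:1910.07686 — 6 statements merged into one kernel-verified Lean document; each statement's English description precedes it below -/
import Mathlib

section
/- Let Γ be a connected strongly regular graph with parameters (v, k, λ, μ) whose nonzero Laplacian eigenvalues r and s are integers. Then the integer rs annihilates the critical group K(Γ), i.e., rs·x = 0 for every x ∈ K(Γ). -/
open SimpleGraph

/-- The critical group of a finite graph `G`: the torsion part of the cokernel of the
Laplacian matrix, viewed as a `ℤ`-linear map `ℤ^V → ℤ^V`. -/
noncomputable abbrev criticalGroup {V : Type*} [Fintype V] [DecidableEq V]
    (G : SimpleGraph V) [DecidableRel G.Adj] :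
    Submodule ℤ ((V → ℤ) ⧸ LinearMap.range (Matrix.toLin' (G.lapMatrix ℤ))) :=
  Submodule.torsion ℤ _

namespace SimpleGraph

variable {V R : Type*} [Fintype V] [DecidableEq V] {G : SimpleGraph V} [DecidableRel G.Adj]

/-- The image of the Laplacian consists of vectors with zero coordinate sum. -/
theorem sum_lapMatrix_mulVec [CommRing R] (x : V → R) :
    ∑ i, (G.lapMatrix R).mulVec x i = 0 := by
  have h := Matrix.dotProduct_mulVec (fun _ : V ↦ (1 : R)) (G.lapMatrix R) x
  rw [← Matrix.mulVec_transpose, (G.isSymm_lapMatrix R).eq, lapMatrix_mulVec_const_eq_zero,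
    zero_dotProduct] at h
  simpa [dotProduct] using h

/-- The Laplacian of a `k`-regular graph is `k - A`. -/
theorem IsRegularOfDegree.lapMatrix_eq [Ring R] {k : ℕ} (h : G.IsRegularOfDegree k) :
    G.lapMatrix R = (k : R) • (1 : Matrix V V R) - G.adjMatrix R := by
  simp only [lapMatrix, degMatrix, h.degree_eq, Matrix.smul_one_eq_diagonal]

omit [Fintype V] in
theorem one_add_adjMatrix_add_adjMatrix_compl [NonAssocSemiring R] :
    1 + G.adjMatrix R + Gᶜ.adjMatrix R = Matrix.of 1 := by
  classical
  rw [← compl_adjMatrix_eq_adjMatrix_compl, one_add_adjMatrix_add_compl_adjMatrix_eq_of_one]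

/-- The quadratic equation satisfied by the Laplacian of a strongly regular graph. -/
theorem IsSRGWith.lapMatrix_sq [CommRing R] {v k l m : ℕ} (h : G.IsSRGWith v k l m) :
    G.lapMatrix R ^ 2 = (2 * k - l + m : R) • G.lapMatrix R
      - (k ^ 2 - (l - m) * k - k + m : R) • (1 : Matrix V V R) + (m : R) • Matrix.of 1 := by
  have hA := h.matrix_eq (α := R)
  simp only [← Nat.cast_smul_eq_nsmul R] at hA
  have hL : G.lapMatrix R ^ 2 =
      (k ^ 2 : R) • 1 - (2 * k : R) • G.adjMatrix R + G.adjMatrix R ^ 2 := by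
    rw [h.regular.lapMatrix_eq]
    simp only [sq, sub_mul, mul_sub, smul_mul_assoc, mul_smul_comm, one_mul, mul_one]
    module
  rw [hL, hA, h.regular.lapMatrix_eq, ← one_add_adjMatrix_add_adjMatrix_compl (G := G)]
  module

/-- On vectors with zero coordinate sum, the Laplacian of a strongly regular graph satisfies a
monic quadratic equation. -/
theorem IsSRGWith.lapMatrix_mulVec_mulVec [CommRing R] {v k l m : ℕ} (h : G.IsSRGWith v k l m)
    {x : V → R} (hx : ∑ i, x i = 0) :
    (G.lapMatrix R).mulVec ((G.lapMatrix R).mulVec x) =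
      (2 * k - l + m : R) • (G.lapMatrix R).mulVec x
        - (k ^ 2 - (l - m) * k - k + m : R) • x := by
  have hJ : (Matrix.of 1 : Matrix V V R).mulVec x = 0 := by
    ext i
    simpa [Matrix.mulVec, dotProduct] using hx
  rw [Matrix.mulVec_mulVec, ← sq, h.lapMatrix_sq]
  simp only [Matrix.add_mulVec, Matrix.sub_mulVec, Matrix.smul_mulVec, Matrix.one_mulVec, hJ,
    smul_zero, add_zero]

/-- A nonzero Laplacian eigenvalue of a strongly regular graph is a root of the quadratic
polynomial determined by the parameters. -/
theorem IsSRGWith.quadratic_of_hasEigenvalue {K : Type*} [Field K] {v k l m : ℕ}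
    (h : G.IsSRGWith v k l m) {r : K}
    (hr : Module.End.HasEigenvalue (Matrix.toLin' (G.lapMatrix K)) r) (hr0 : r ≠ 0) :
    r ^ 2 = (2 * k - l + m) * r - (k ^ 2 - (l - m) * k - k + m) := by
  obtain ⟨x, hx⟩ := hr.exists_hasEigenvector
  have hLx : (G.lapMatrix K).mulVec x = r • x := by
    simpa [Matrix.toLin'_apply] using hx.apply_eq_smul
  have hsum : ∑ i, x i = 0 := by
    have := sum_lapMatrix_mulVec (G := G) x
    simpa [hLx, ← Finset.mul_sum, hr0] using this
  have hquad := h.lapMatrix_mulVec_mulVec hsum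
  rw [hLx, Matrix.mulVec_smul, hLx, smul_smul, smul_smul, ← sub_smul, ← sq] at hquad
  exact smul_left_injective K hx.2 hquad

/-- The product of two distinct nonzero integral Laplacian eigenvalues of a strongly regular
graph in terms of its parameters. -/
theorem IsSRGWith.eigenvalue_mul_eq {v k l m : ℕ} (h : G.IsSRGWith v k l m) {r s : ℤ}
    (hr : Module.End.HasEigenvalue (Matrix.toLin' (G.lapMatrix ℚ)) (r : ℚ))
    (hs : Module.End.HasEigenvalue (Matrix.toLin' (G.lapMatrix ℚ)) (s : ℚ))
    (hrs : r ≠ s) (hr0 : r ≠ 0) (hs0 : s ≠ 0) :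
    r * s = k ^ 2 - (l - m) * k - k + m := by
  have hqr := h.quadratic_of_hasEigenvalue hr (mod_cast hr0)
  have hqs := h.quadratic_of_hasEigenvalue hs (mod_cast hs0)
  have hadd : (r + s : ℚ) = 2 * k - l + m :=
    mul_left_cancel₀ (sub_ne_zero.mpr (Int.cast_injective.ne hrs))
      (by linear_combination hqr - hqs)
  apply Int.cast_injective (α := ℚ)
  push_cast
  linear_combination r * hadd - hqr

end SimpleGraph

/-- If `Γ` is a connected strongly regular graph whose nonzero Laplacian
eigenvalues `r` and `s` are integers, then `r * s` annihilates the critical group `K(Γ)`. -/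
theorem srg_eigenvalue_product_kills_criticalGroup {V : Type*} [Fintype V] [DecidableEq V]
    (G : SimpleGraph V) [DecidableRel G.Adj]
    (v k l m : ℕ) (hsrg : G.IsSRGWith v k l m) (hconn : G.Connected)
    (r s : ℤ)
    (hre : Module.End.HasEigenvalue (Matrix.toLin' (G.lapMatrix ℚ)) (r : ℚ))
    (hse : Module.End.HasEigenvalue (Matrix.toLin' (G.lapMatrix ℚ)) (s : ℚ))
    (hrs : r ≠ s) (hr0 : r ≠ 0) (hs0 : s ≠ 0) :
    ∀ x ∈ criticalGroup G, (r * s) • x = 0 := by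
  rintro ⟨x⟩ hx
  obtain ⟨n, hn⟩ := (Submodule.mem_torsion_iff _).mp hx
  obtain ⟨y, hy⟩ := (Submodule.Quotient.mk_eq_zero _).mp hn
  have hsum : ∑ i, x i = 0 := by
    have := sum_lapMatrix_mulVec (G := G) y
    rw [← Matrix.toLin'_apply, hy] at this
    have : (n : ℤ) * ∑ i, x i = 0 := by
      rw [Finset.mul_sum]
      exact this
    exact (mul_eq_zero.mp this).resolve_left (nonZeroDivisors.coe_ne_zero n)
  refine (Submodule.Quotient.mk_eq_zero _).mpr
    ⟨(2 * k - l + m : ℤ) • x - (G.lapMatrix ℤ).mulVec x, ?_⟩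
  rw [Matrix.toLin'_apply, Matrix.mulVec_sub, Matrix.mulVec_smul,
    hsrg.lapMatrix_mulVec_mulVec hsum, hsrg.eigenvalue_mul_eq hre hse hrs hr0 hs0, sub_sub_cancel]
end

section
/- Let Γ be a finite connected simple graph with Laplacian matrix L, let p be a prime, and let e_j denote the multiplicity of p^j as an elementary divisor of L. Let η be an integer eigenvalue of L (over Q) with multiplicity m. If p^i divides η, then m ≤ 1 + Σ_{j ≥ i} e_j. -/
open SimpleGraph Finset

/-- A nonzero rational vector is proportional to a primitive integer vector. -/
lemma exists_gcd_eq_one_smul_eq_intCast {ι : Type*} [Fintype ι] {y : ι → ℚ} (hy : y ≠ 0) :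
    ∃ (q : ℚ) (z : ι → ℤ), Finset.univ.gcd z = 1 ∧ ∀ k, (z k : ℚ) = q * y k := by
  obtain ⟨k₀, hk₀⟩ := Function.ne_iff.mp hy
  obtain ⟨b, hb⟩ := IsLocalization.exist_integer_multiples_of_finite (nonZeroDivisors ℤ) y
  choose w hw using hb
  have hb0 : ((b : ℤ) : ℚ) ≠ 0 := by
    exact_mod_cast nonZeroDivisors.ne_zero b.2
  have hw' : ∀ k, (w k : ℚ) = (b : ℤ) * y k := fun k => by
    simpa [zsmul_eq_mul] using hw k
  obtain ⟨z, hz, hz1⟩ := Finset.extract_gcd w ⟨k₀, Finset.mem_univ _⟩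
  have hg : Finset.univ.gcd w ≠ 0 := fun h => by
    have h0 := hw' k₀
    rw [Finset.gcd_eq_zero_iff.mp h k₀ (Finset.mem_univ _)] at h0
    simp_all
  refine ⟨((b : ℤ) : ℚ) / (Finset.univ.gcd w : ℤ), z, hz1, fun k => ?_⟩
  have hgq : ((Finset.univ.gcd w : ℤ) : ℚ) ≠ 0 := by exact_mod_cast hg
  rw [div_mul_eq_mul_div, ← hw' k, eq_div_iff hgq]
  exact_mod_cast (mul_comm _ _).trans (hz k (Finset.mem_univ _)).symm

/-- If a diagonal matrix `S` is equivalent over `ℤ` to `L` and `p ^ i ∣ η`, then the eigenspace of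
`L` for `η` has dimension at most the number of diagonal entries of `S` divisible by `p ^ i`. -/
lemma finrank_eigenspace_le_card_pow_dvd_diag {ι : Type*} [Fintype ι] [DecidableEq ι]
    {p : ℕ} (hp : p.Prime) {L U W S : Matrix ι ι ℤ} (hW : IsUnit W.det) (hS : U * L * W = S)
    (hdiag : ∀ k l : ι, k ≠ l → S k l = 0) {η : ℤ} {i : ℕ} (hη : (p : ℤ) ^ i ∣ η) :
    Module.finrank ℚ
        (Module.End.eigenspace (Matrix.toLin' (L.map (Int.cast : ℤ → ℚ))) (η : ℚ)) ≤
      Fintype.card {k : ι // (p : ℤ) ^ i ∣ S k k} := by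
  by_contra! hlt
  let E := Module.End.eigenspace (Matrix.toLin' (L.map (Int.cast : ℤ → ℚ))) (η : ℚ)
  let f : E →ₗ[ℚ] ({k : ι // (p : ℤ) ^ i ∣ S k k} → ℚ) :=
    LinearMap.funLeft ℚ ℚ Subtype.val ∘ₗ
      Matrix.toLin' (W⁻¹.map (Int.cast : ℤ → ℚ)) ∘ₗ E.subtype
  have hf : LinearMap.ker f ≠ ⊥ := f.ker_ne_bot_of_finrank_lt (by simpa using hlt)
  obtain ⟨⟨x, hxE⟩, hx, hx0⟩ := (Submodule.ne_bot_iff _).mp hf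
  let y : ι → ℚ := (W⁻¹.map (Int.cast : ℤ → ℚ)).mulVec x
  have hyK : ∀ k, (p : ℤ) ^ i ∣ S k k → y k = 0 := fun k hk =>
    congrFun (LinearMap.mem_ker.mp hx) ⟨k, hk⟩
  have hWy : (W.map (Int.cast : ℤ → ℚ)).mulVec y = x := by
    have h := congrArg (Int.castRingHom ℚ).mapMatrix (Matrix.mul_nonsing_inv W hW)
    rw [map_mul, map_one] at h
    simp only [RingHom.mapMatrix_apply, Int.coe_castRingHom] at h
    rw [Matrix.mulVec_mulVec, h, Matrix.one_mulVec]
  have hy : y ≠ 0 := by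
    intro h
    rw [h, Matrix.mulVec_zero] at hWy
    exact hx0 (Subtype.ext hWy.symm)
  obtain ⟨q, z, hz1, hz⟩ := exists_gcd_eq_one_smul_eq_intCast hy
  have hcast : ∀ (M : Matrix ι ι ℤ) (v : ι → ℤ),
      (M.map (Int.cast : ℤ → ℚ)).mulVec (fun k => (v k : ℚ)) =
        fun k => ((M.mulVec v k : ℤ) : ℚ) := fun M v => by
    ext k
    simp [Matrix.mulVec, dotProduct]
  have hzq : (fun k => (z k : ℚ)) = q • y := funext hz
  have hWz : (fun k => ((W.mulVec z k : ℤ) : ℚ)) = q • x := by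
    rw [← hcast, hzq, Matrix.mulVec_smul, hWy]
  have hLx : (L.map (Int.cast : ℤ → ℚ)).mulVec x = (η : ℚ) • x := by
    simpa using Module.End.mem_eigenspace_iff.mp hxE
  have hLWz : L.mulVec (W.mulVec z) = η • W.mulVec z := by
    ext k
    have h := congrFun (hcast L (W.mulVec z)) k
    rw [hWz, Matrix.mulVec_smul, hLx, smul_comm, ← hWz] at h
    simp only [Pi.smul_apply, smul_eq_mul] at h ⊢
    exact_mod_cast h.symm
  have hSz : S.mulVec z = η • U.mulVec (W.mulVec z) := by
    rw [← hS, ← Matrix.mulVec_mulVec, ← Matrix.mulVec_mulVec, hLWz, Matrix.mulVec_smul]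
  have hSd : ∀ k, S.mulVec z k = S k k * z k := fun k => by
    rw [Matrix.mulVec, dotProduct]
    exact Finset.sum_eq_single k (fun l _ hl => by rw [hdiag k l hl.symm, zero_mul]) (by simp)
  have hpz : ∀ k, (p : ℤ) ∣ z k := fun k => by
    by_cases hk : (p : ℤ) ^ i ∣ S k k
    · have h0 : z k = 0 := by
        have h := hz k
        rw [hyK k hk, mul_zero] at h
        exact_mod_cast h
      simp [h0]
    · by_contra hnd
      refine hk ((Nat.prime_iff_prime_int.mp hp).pow_dvd_of_dvd_mul_right i hnd ?_)
      rw [← hSd, hSz]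
      exact hη.mul_right _
  have h1 : (p : ℤ) ∣ 1 := hz1 ▸ Finset.dvd_gcd fun k _ => hpz k
  exact (Nat.prime_iff_prime_int.mp hp).not_dvd_one h1

/-- Integer vectors in the kernel of the Laplacian of a connected graph are constant. -/
lemma eq_of_lapMatrix_mulVec_eq_zero {V : Type*} [Fintype V] [DecidableEq V] {G : SimpleGraph V}
    [DecidableRel G.Adj] (hconn : G.Connected) {v : V → ℤ} (hv : (G.lapMatrix ℤ).mulVec v = 0)
    (a b : V) : v a = v b := by
  have h : (G.lapMatrix ℝ).mulVec (fun k => (v k : ℝ)) = 0 := by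
    ext k
    have hk := congrFun hv k
    rw [lapMatrix_mulVec_apply, Pi.zero_apply] at hk ⊢
    exact_mod_cast hk
  exact_mod_cast (G.lapMatrix_mulVec_eq_zero_iff_forall_reachable.mp h) a b (hconn a b)

/-- A diagonal integer matrix equivalent to the Laplacian of a connected graph has at most one zero
on its diagonal. -/
lemma eq_of_diag_eq_zero_of_lapMatrix_equiv {V : Type*} [Fintype V] [DecidableEq V]
    {G : SimpleGraph V} [DecidableRel G.Adj] (hconn : G.Connected) {U W S : Matrix V V ℤ}
    (hU : IsUnit U.det) (hW : IsUnit W.det) (hS : U * G.lapMatrix ℤ * W = S)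
    (hdiag : ∀ k l : V, k ≠ l → S k l = 0) {k l : V} (hk : S k k = 0) (hl : S l l = 0) :
    k = l := by
  by_contra hkl
  have hUinj := Matrix.mulVec_injective_of_isUnit ((Matrix.isUnit_iff_isUnit_det U).mpr hU)
  have hWinj := Matrix.mulVec_injective_of_isUnit ((Matrix.isUnit_iff_isUnit_det W).mpr hW)
  have hcol : ∀ j, S j j = 0 → ∀ a b, W a j = W b j := fun j hj a b => by
    suffices h : (G.lapMatrix ℤ).mulVec (W.mulVec (Pi.single j 1)) = 0 by
      simpa using eq_of_lapMatrix_mulVec_eq_zero hconn h a b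
    apply hUinj
    rw [Matrix.mulVec_mulVec, Matrix.mulVec_mulVec, hS, Matrix.mulVec_zero,
      Matrix.mulVec_single_one]
    ext a
    by_cases h : a = j
    · simpa [h] using hj
    · simpa using hdiag a j h
  have hzero : W k l • Pi.single k 1 - W k k • Pi.single l 1 = (0 : V → ℤ) := by
    apply hWinj
    rw [Matrix.mulVec_zero, Matrix.mulVec_sub, Matrix.mulVec_smul, Matrix.mulVec_smul,
      Matrix.mulVec_single_one, Matrix.mulVec_single_one]
    ext a
    simp [hcol k hk a k, hcol l hl a k, mul_comm]
  have hWkk : W k k = 0 := by simpa [hkl, Ne.symm hkl] using congrFun hzero l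
  have hsingle : (Pi.single k 1 : V → ℤ) = 0 := by
    apply hWinj
    rw [Matrix.mulVec_zero, Matrix.mulVec_single_one]
    ext a
    simp [hcol k hk a k, hWkk]
  simpa using congrFun hsingle k

/-- The number of nonzero entries of an integer family divisible by `p ^ i` is the sum over `j ≥ i`
of the number of entries exactly divisible by `p ^ j`. -/
lemma card_pow_dvd_and_ne_zero_le_sum {ι : Type*} [Fintype ι] {p : ℕ} (hp : p.Prime)
    (s : ι → ℤ) {e : ℕ → ℕ}
    (he : ∀ j, e j = Nat.card {k : ι // (p : ℤ) ^ j ∣ s k ∧ ¬ (p : ℤ) ^ (j + 1) ∣ s k})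
    {N : ℕ} (hN : ∀ j, N ≤ j → e j = 0) (i : ℕ) :
    (Finset.univ.filter fun k => (p : ℤ) ^ i ∣ s k ∧ s k ≠ 0).card ≤
      ∑ j ∈ Finset.Ico i N, e j := by
  classical
  have : Fact p.Prime := ⟨hp⟩
  have he' : ∀ j, e j =
      (Finset.univ.filter fun k => (p : ℤ) ^ j ∣ s k ∧ ¬ (p : ℤ) ^ (j + 1) ∣ s k).card :=
    fun j => by rw [he, Nat.card_eq_fintype_card, Fintype.card_subtype]
  simp_rw [he'] at hN ⊢
  refine le_trans (Finset.card_le_card fun k hk => ?_) Finset.card_biUnion_le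
  obtain ⟨-, hik, hk0⟩ := Finset.mem_filter.mp hk
  have hval : (p : ℤ) ^ padicValInt p (s k) ∣ s k ∧
      ¬ (p : ℤ) ^ (padicValInt p (s k) + 1) ∣ s k :=
    ⟨padicValInt_dvd _, fun h => by simpa [hk0] using (padicValInt_dvd_iff _ _).mp h⟩
  have hmem : k ∈ Finset.univ.filter fun l => (p : ℤ) ^ padicValInt p (s k) ∣ s l ∧
      ¬ (p : ℤ) ^ (padicValInt p (s k) + 1) ∣ s l := by simpa using hval
  refine Finset.mem_biUnion.mpr ⟨padicValInt p (s k), Finset.mem_Ico.mpr ⟨?_, ?_⟩, hmem⟩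
  · exact ((padicValInt_dvd_iff _ _).mp hik).resolve_left hk0
  · by_contra! h
    rw [Finset.card_eq_zero.mp (hN _ h)] at hmem
    simp at hmem

/-- Let `Γ` be a finite connected graph with Laplacian `L`, `p` a prime, and
`e j` the multiplicity of `p^j` as an elementary divisor of `L` (i.e. the number of invariant
factors, read off from a Smith normal form `S = U * L * W`, that are exactly divisible by `p^j`).
If `η` is an integer eigenvalue of `L` (over `ℚ`) of multiplicity `m` and `p^i ∣ η`, then
`m ≤ 1 + ∑_{j ≥ i} e j` (the sum written over `Ico i N` for any `N` past which `e` vanishes). -/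
theorem eigenvalue_multiplicity_le_one_add_sum_elementaryDivisors
    {n : ℕ} (G : SimpleGraph (Fin n)) [DecidableRel G.Adj] (hconn : G.Connected)
    (p : ℕ) (hp : p.Prime)
    (U W S : Matrix (Fin n) (Fin n) ℤ)
    (hU : IsUnit U.det) (hW : IsUnit W.det)
    (hS : U * G.lapMatrix ℤ * W = S)
    (hdiag : ∀ i j : Fin n, i ≠ j → S i j = 0)
    (hdvd : ∀ i j : Fin n, i ≤ j → S i i ∣ S j j)
    (e : ℕ → ℕ)
    (he : ∀ j : ℕ,
      e j = Nat.card {i : Fin n // (p : ℤ) ^ j ∣ S i i ∧ ¬ (p : ℤ) ^ (j + 1) ∣ S i i})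
    (η : ℤ) (m i : ℕ)
    (heig : Module.End.HasEigenvalue (Matrix.toLin' (G.lapMatrix ℚ)) (η : ℚ))
    (hm : Module.finrank ℚ (Module.End.eigenspace (Matrix.toLin' (G.lapMatrix ℚ)) (η : ℚ)) = m)
    (hη : (p : ℤ) ^ i ∣ η)
    (N : ℕ) (hN : ∀ j : ℕ, N ≤ j → e j = 0) :
    m ≤ 1 + ∑ j ∈ Finset.Ico i N, e j := by
  have hmap : (G.lapMatrix ℤ).map (Int.cast : ℤ → ℚ) = G.lapMatrix ℚ := by
    ext a b
    by_cases hab : a = b <;>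
      simp [lapMatrix, degMatrix, adjMatrix_apply, hab, apply_ite]
  have hdim := finrank_eigenspace_le_card_pow_dvd_diag hp hW hS hdiag hη
  rw [hmap, hm, Fintype.card_subtype] at hdim
  refine hdim.trans ?_
  rw [← Finset.card_filter_add_card_filter_not (fun k => S k k = 0), Finset.filter_filter,
    Finset.filter_filter]
  refine add_le_add (Finset.card_le_one.mpr fun k hk l hl => ?_)
    (card_pow_dvd_and_ne_zero_le_sum hp (fun k => S k k) he hN i)
  exact eq_of_diag_eq_zero_of_lapMatrix_equiv hconn hU hW hS hdiag
    (Finset.mem_filter.mp hk).2.2 (Finset.mem_filter.mp hl).2.2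
end

section
/- Let Γ be a finite connected simple graph with Laplacian matrix L, let p be a prime, and let e_j denote the multiplicity of p^j as an elementary divisor of L. Let η be an integer eigenvalue of L (over Q) with multiplicity m. If p^i exactly divides η (i.e., p^i | η and p^{i+1} ∤ η), then m ≤ Σ_{0 ≤ j ≤ i} e_j. -/
open SimpleGraph Finset

/-- A nonzero rational vector is a nonzero multiple of a primitive integer vector. -/
theorem exists_eq_smul_primitive_int {ι : Type*} [Fintype ι] (x : ι → ℚ) (hx : x ≠ 0) :
    ∃ (c : ℚ) (g : ι → ℤ), c ≠ 0 ∧ (∀ i, x i = c * g i) ∧ Finset.univ.gcd g = 1 := by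
  obtain ⟨b, hb⟩ := IsLocalization.exist_integer_multiples (nonZeroDivisors ℤ) Finset.univ x
  choose f hf using fun i => hb i (Finset.mem_univ i)
  obtain ⟨k, hk⟩ := Function.ne_iff.mp hx
  obtain ⟨g, hg, hg1⟩ := Finset.extract_gcd f ⟨k, Finset.mem_univ k⟩
  have hb0 : ((b : ℤ) : ℚ) ≠ 0 := by exact_mod_cast nonZeroDivisors.coe_ne_zero b
  have hxg : ∀ i, x i = ((Finset.univ.gcd f : ℤ) : ℚ) / ((b : ℤ) : ℚ) * g i := by
    intro i
    have h1 : (f i : ℚ) = ((b : ℤ) : ℚ) * x i := by simpa using hf i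
    have h2 : (f i : ℚ) = ((Finset.univ.gcd f : ℤ) : ℚ) * g i := by
      exact_mod_cast hg i (Finset.mem_univ i)
    rw [div_mul_eq_mul_div, eq_div_iff hb0, ← h2, h1, mul_comm]
  refine ⟨_, g, fun h0 => hk ?_, hxg, hg1⟩
  rw [hxg k, h0, zero_mul, Pi.zero_apply]

/-- Counting integers by the exact power of `q` dividing them. -/
theorem sum_card_exactly_divisible {ι : Type*} [Fintype ι] (q : ℤ) (d : ι → ℤ) (t : ℕ) :
    ∑ j ∈ Finset.range t, Nat.card {k : ι // q ^ j ∣ d k ∧ ¬ q ^ (j + 1) ∣ d k} =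
      Nat.card {k : ι // ¬ q ^ t ∣ d k} := by
  classical
  induction t with
  | zero => simp
  | succ t ih =>
    rw [Finset.sum_range_succ, ih]
    simp only [Nat.card_eq_fintype_card, Fintype.card_subtype]
    rw [← Finset.card_union_of_disjoint]
    · congr 1
      ext k
      have : q ^ (t + 1) ∣ d k → q ^ t ∣ d k := (pow_dvd_pow q t.le_succ).trans
      simp only [Finset.mem_union, Finset.mem_filter, Finset.mem_univ, true_and]
      tauto
    · rw [Finset.disjoint_filter]
      tauto

/-- If `S = U * A * W` is diagonal with `U`, `W` unimodular, then the multiplicity of an integer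
eigenvalue of `A` not divisible by `q` is at most the number of diagonal entries of `S` not
divisible by `q`. -/
theorem finrank_eigenspace_le_card_not_dvd {ι : Type*} [Fintype ι] [DecidableEq ι]
    (A U W S : Matrix ι ι ℤ) (hU : IsUnit U.det) (hW : IsUnit W.det) (hS : U * A * W = S)
    (hdiag : ∀ i j, i ≠ j → S i j = 0) (q η : ℤ) (hη : ¬ q ∣ η) :
    Module.finrank ℚ (Module.End.eigenspace
      (Matrix.toLin' (A.map (Int.cast : ℤ → ℚ))) (η : ℚ)) ≤ Nat.card {k : ι // ¬ q ∣ S k k} := by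
  classical
  by_contra! hlt
  let f : (ι → ℚ) →ₗ[ℚ] ({k : ι // ¬ q ∣ S k k} → ℚ) :=
    (LinearMap.funLeft ℚ ℚ Subtype.val) ∘ₗ Matrix.toLin' (W⁻¹.map (Int.cast : ℤ → ℚ))
  obtain ⟨⟨x, hxE⟩, hxker, hx0⟩ := Submodule.exists_mem_ne_zero_of_ne_bot
    (LinearMap.ker_ne_bot_of_finrank_lt (f := f.domRestrict (Module.End.eigenspace
      (Matrix.toLin' (A.map (Int.cast : ℤ → ℚ))) (η : ℚ)))
      (by simpa [Nat.card_eq_fintype_card] using hlt))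
  have hx0' : x ≠ 0 := fun h => hx0 (Subtype.ext h)
  obtain ⟨c, g, hc, hxg, hg⟩ := exists_eq_smul_primitive_int x hx0'
  have hcast : ∀ B : Matrix ι ι ℤ, ∀ k,
      (B.map (Int.cast : ℤ → ℚ)).mulVec x k = c * ((B.mulVec g k : ℤ) : ℚ) := by
    intro B k
    simp only [Matrix.mulVec, dotProduct, Matrix.map_apply, hxg, Int.cast_sum, Int.cast_mul,
      Finset.mul_sum]
    exact Finset.sum_congr rfl fun _ _ => by ring
  have hAg : A.mulVec g = η • g := by
    funext k
    have h := congrFun (Module.End.mem_eigenspace_iff.mp hxE) k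
    rw [Matrix.toLin'_apply, hcast, Pi.smul_apply, hxg, smul_eq_mul, mul_left_comm] at h
    exact_mod_cast mul_left_cancel₀ hc h
  have hWg : ∀ k, ¬ q ∣ S k k → W⁻¹.mulVec g k = 0 := by
    intro k hk
    have h : (W⁻¹.map (Int.cast : ℤ → ℚ)).mulVec x k = 0 := congrFun hxker ⟨k, hk⟩
    rw [hcast] at h
    exact_mod_cast (mul_eq_zero.mp h).resolve_left hc
  have hUAg : U.mulVec (η • g) = S.mulVec (W⁻¹.mulVec g) := by
    rw [← hAg, Matrix.mulVec_mulVec, Matrix.mulVec_mulVec, ← hS,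
      Matrix.mul_nonsing_inv_cancel_right _ _ hW]
  have hdvd : ∀ k, q ∣ U.mulVec (η • g) k := by
    intro k
    rw [hUAg, Matrix.mulVec, dotProduct, Finset.sum_eq_single k
      (fun j _ hj => by rw [hdiag k j hj.symm, zero_mul]) (by simp)]
    by_cases hk : q ∣ S k k
    · exact hk.mul_right _
    · simp [hWg k hk]
  have hdvd' : ∀ k, q ∣ η * g k := by
    intro k
    have h : U⁻¹.mulVec (U.mulVec (η • g)) = η • g := by
      rw [Matrix.mulVec_mulVec, Matrix.nonsing_inv_mul _ hU, Matrix.one_mulVec]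
    have hk : η * g k = U⁻¹.mulVec (U.mulVec (η • g)) k := by rw [h]; simp
    rw [hk]
    exact Finset.dvd_sum fun j _ => (hdvd j).mul_left _
  apply hη
  have h : q ∣ Finset.univ.gcd fun k => η * g k := Finset.dvd_gcd fun k _ => hdvd' k
  rwa [Finset.gcd_mul_left, hg, mul_one, dvd_normalize_iff] at h

/-- Let `Γ` be a finite connected graph with Laplacian `L`, `p` a prime, and
`e j` the multiplicity of `p^j` as an elementary divisor of `L` (i.e. the number of invariant
factors, read off from a Smith normal form `S = U * L * W`, that are exactly divisible by `p^j`).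
If `η` is an integer eigenvalue of `L` (over `ℚ`) of multiplicity `m` and `p^i` exactly
divides `η`, then `m ≤ ∑_{0 ≤ j ≤ i} e j`. -/
theorem eigenvalue_multiplicity_le_sum_elementaryDivisors
    {n : ℕ} (G : SimpleGraph (Fin n)) [DecidableRel G.Adj] (hconn : G.Connected)
    (p : ℕ) (hp : p.Prime)
    (U W S : Matrix (Fin n) (Fin n) ℤ)
    (hU : IsUnit U.det) (hW : IsUnit W.det)
    (hS : U * G.lapMatrix ℤ * W = S)
    (hdiag : ∀ i j : Fin n, i ≠ j → S i j = 0)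
    (hdvd : ∀ i j : Fin n, i ≤ j → S i i ∣ S j j)
    (e : ℕ → ℕ)
    (he : ∀ j : ℕ,
      e j = Nat.card {i : Fin n // (p : ℤ) ^ j ∣ S i i ∧ ¬ (p : ℤ) ^ (j + 1) ∣ S i i})
    (η : ℤ) (m i : ℕ)
    (heig : Module.End.HasEigenvalue (Matrix.toLin' (G.lapMatrix ℚ)) (η : ℚ))
    (hm : Module.finrank ℚ (Module.End.eigenspace (Matrix.toLin' (G.lapMatrix ℚ)) (η : ℚ)) = m)
    (hη : (p : ℤ) ^ i ∣ η) (hη' : ¬ (p : ℤ) ^ (i + 1) ∣ η) :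
    m ≤ ∑ j ∈ Finset.range (i + 1), e j := by
  subst hm
  have hmap : G.lapMatrix ℚ = (G.lapMatrix ℤ).map (Int.cast : ℤ → ℚ) := by
    ext a b
    simp [SimpleGraph.lapMatrix, SimpleGraph.degMatrix, Matrix.diagonal_apply,
      SimpleGraph.adjMatrix_apply, apply_ite (Int.cast : ℤ → ℚ)]
  simp only [he]
  rw [sum_card_exactly_divisible (p : ℤ) (fun k => S k k), hmap]
  exact finrank_eigenspace_le_card_not_dvd _ U W S hU hW hS hdiag _ η hη'
end

section
/- Let Γ be a connected strongly regular graph with parameters (v, k, λ, μ) whose nonzero Laplacian eigenvalues r and s are integers, with multiplicities f and g respectively, and let p be a prime dividing |K(Γ)| with p ∤ r and p^a ∥ s (a ≥ 1). Let e_a denote the multiplicity of p^a as an elementary divisor of the Laplacian L. Then g − 1 ≤ e_a ≤ g. -/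
open SimpleGraph

open Matrix in
/-- The quadratic relation satisfied by the Laplacian of a strongly regular graph. -/
lemma SimpleGraph.IsSRGWith.lapMatrix_mul_self {V R : Type*} [Fintype V] [DecidableEq V]
    [CommRing R] {G : SimpleGraph V} [DecidableRel G.Adj] {n k l m : ℕ}
    (h : G.IsSRGWith n k l m) :
    G.lapMatrix R * G.lapMatrix R =
      (2 * k - l + m : R) • G.lapMatrix R - (k ^ 2 - k - l * k + m + m * k : R) • 1
        + (m : R) • of fun _ _ => 1 := by
  classical
  have hA : G.adjMatrix R = (k : R) • 1 - G.lapMatrix R := by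
    ext i j
    simp [lapMatrix, degMatrix, Matrix.diagonal_apply, h.regular.degree_eq, Matrix.one_apply]
  have hC : Gᶜ.adjMatrix R = (of fun _ _ => 1) - 1 - G.adjMatrix R := by
    ext i j
    by_cases hij : i = j
    · simp [hij]
    · by_cases hadj : G.Adj i j <;> simp [hij, hadj]
  have hsq := h.matrix_eq (α := R)
  rw [hC, hA, sq] at hsq
  simp only [sub_mul, mul_sub, smul_mul_assoc, mul_smul_comm, one_mul, mul_one,
    ← Nat.cast_smul_eq_nsmul R] at hsq
  ext i j
  have hij := congr_fun (congr_fun hsq i) j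
  simp only [Matrix.sub_apply, Matrix.add_apply, Matrix.smul_apply, smul_eq_mul] at hij ⊢
  linear_combination hij

lemma SimpleGraph.sum_lapMatrix_mulVec_s7 {V R : Type*} [Fintype V] [DecidableEq V]
    [CommRing R] (G : SimpleGraph V) [DecidableRel G.Adj] (x : V → R) :
    ∑ i, (G.lapMatrix R).mulVec x i = 0 := by
  have h : (G.lapMatrix R).vecMul (fun _ => 1) = 0 := by
    rw [← Matrix.mulVec_transpose, (G.isSymm_lapMatrix R).eq, lapMatrix_mulVec_const_eq_zero]
  have h' := Matrix.dotProduct_mulVec (fun _ => (1 : R)) (G.lapMatrix R) x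
  simpa [h, dotProduct] using h'

/-- A nonzero rational subspace contains an integer vector with an entry prime to `p`. -/
lemma exists_int_vector_not_dvd {n : Type*} [Fintype n] {p : ℤ} (hp : ¬ IsUnit p)
    {F : Submodule ℚ (n → ℚ)} (hF : F ≠ ⊥) :
    ∃ z : n → ℤ, (fun i => (z i : ℚ)) ∈ F ∧ ∃ i, ¬ p ∣ z i := by
  classical
  obtain ⟨x, hx, hx0⟩ := F.ne_bot_iff.mp hF
  obtain ⟨b, hb⟩ := IsLocalization.exist_integer_multiples_of_finite (nonZeroDivisors ℤ) x
  choose y hy using hb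
  have hb0 : ((b : ℤ) : ℚ) ≠ 0 := by exact_mod_cast nonZeroDivisors.ne_zero b.2
  have hy' : ∀ i, (y i : ℚ) = (b : ℤ) * x i := fun i => by simpa using hy i
  obtain ⟨i₀, hi₀⟩ := Function.ne_iff.mp hx0
  have hyi : y i₀ ≠ 0 := fun h => by
    have := hy' i₀
    rw [h, Int.cast_zero, eq_comm, mul_eq_zero] at this
    exact this.elim hb0 hi₀
  obtain ⟨z, hz, hgcd⟩ := Finset.univ.extract_gcd y ⟨i₀, Finset.mem_univ _⟩
  have hd0 : ((Finset.univ.gcd y : ℤ) : ℚ) ≠ 0 := by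
    intro h
    exact hyi (Finset.gcd_eq_zero_iff.mp (by exact_mod_cast h) i₀ (Finset.mem_univ _))
  refine ⟨z, ?_, ?_⟩
  · have : (fun i => (z i : ℚ)) = (((Finset.univ.gcd y : ℤ) : ℚ)⁻¹ * (b : ℤ)) • x := by
      ext i
      rw [Pi.smul_apply, smul_eq_mul, mul_assoc, ← hy', hz i (Finset.mem_univ _), Int.cast_mul,
        inv_mul_cancel_left₀ hd0]
    rw [this]
    exact F.smul_mem _ hx
  · by_contra! h
    exact hp (isUnit_of_dvd_one (hgcd ▸ Finset.dvd_gcd fun i _ => h i))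

/-- If every integer vector `x` of a rational subspace `E` for which `M x` vanishes on `K` has
`M x` divisible by `p`, where `M` is unimodular, then `dim E ≤ |K|`. -/
lemma finrank_le_card_of_forall_dvd {n : Type*} [Fintype n] [DecidableEq n] {p : ℤ}
    (hp : ¬ IsUnit p) (E : Submodule ℚ (n → ℚ)) (K : Finset n) {M N : Matrix n n ℤ}
    (hMN : M * N = 1)
    (h : ∀ x : n → ℤ, (fun i => (x i : ℚ)) ∈ E → (∀ i ∈ K, M.mulVec x i = 0) →
      ∀ i, p ∣ M.mulVec x i) :
    Module.finrank ℚ E ≤ K.card := by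
  by_contra! hlt
  let N' : Matrix n n ℚ := N.map (Int.castRingHom ℚ)
  let M' : Matrix n n ℚ := M.map (Int.castRingHom ℚ)
  have hNM' : N' * M' = 1 := by
    rw [← Matrix.map_mul, mul_eq_one_comm.mp hMN]
    simp
  let φ : E →ₗ[ℚ] (K → ℚ) :=
    LinearMap.pi fun i => (LinearMap.proj (i : n)) ∘ₗ M'.mulVecLin ∘ₗ E.subtype
  have hker : LinearMap.ker φ ≠ ⊥ := LinearMap.ker_ne_bot_of_finrank_lt (by simpa using hlt)
  obtain ⟨⟨x, hxE⟩, hx, hx0⟩ := (Submodule.ne_bot_iff _).mp hker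
  let F : Submodule ℚ (n → ℚ) := E.comap N'.mulVecLin ⊓
    ⨅ i ∈ K, LinearMap.ker (LinearMap.proj (R := ℚ) (φ := fun _ : n => ℚ) i)
  have hNMx : N'.mulVec (M'.mulVec x) = x := by
    rw [Matrix.mulVec_mulVec, hNM', Matrix.one_mulVec]
  have hF : F ≠ ⊥ := by
    refine (Submodule.ne_bot_iff _).mpr ⟨M'.mulVec x, ⟨?_, ?_⟩, ?_⟩
    · simpa [hNMx] using hxE
    · simp only [SetLike.mem_coe, Submodule.mem_iInf, LinearMap.mem_ker, LinearMap.proj_apply]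
      intro i hi
      exact congr_fun hx ⟨i, hi⟩
    · intro h0
      apply hx0
      rw [h0, Matrix.mulVec_zero] at hNMx
      exact Subtype.ext hNMx.symm
  obtain ⟨z, ⟨hzE, hzK⟩, i, hi⟩ := exists_int_vector_not_dvd hp hF
  have hMN_z : M.mulVec (N.mulVec z) = z := by
    rw [Matrix.mulVec_mulVec, hMN, Matrix.one_mulVec]
  refine hi ?_
  rw [← hMN_z]
  refine h (N.mulVec z) ?_ ?_ i
  · have : (fun i => ((N.mulVec z i : ℤ) : ℚ)) = N'.mulVec (fun i => (z i : ℚ)) := by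
      ext i
      simp [N', Matrix.mulVec, dotProduct]
    rw [this]
    exact hzE
  · rw [hMN_z]
    intro j hj
    simp only [SetLike.mem_coe, Submodule.mem_iInf, LinearMap.mem_ker, LinearMap.proj_apply] at hzK
    exact_mod_cast hzK j hj

lemma finrank_le_finrank_eigenspace_add {F M : Type*} [Field F] [AddCommGroup M] [Module F M]
    [FiniteDimensional F M] (T : Module.End F M) {r s : F} (hrs : r ≠ s) (hr : r ≠ 0)
    (hs : s ≠ 0) {w : M} (hw : T w = 0)
    (h : ∀ x, ∃ t : F, T (T x) - (r + s) • T x + (r * s) • x = t • w) :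
    Module.finrank F M ≤
      Module.finrank F (T.eigenspace r) + Module.finrank F (T.eigenspace s) + 1 := by
  have htop : T.eigenspace r ⊔ T.eigenspace s ⊔ F ∙ w = ⊤ := by
    refine eq_top_iff.mpr fun x _ => ?_
    obtain ⟨t, ht⟩ := h x
    have h1 : r - s ≠ 0 := sub_ne_zero.mpr hrs
    set y := x - (t / (r * s)) • w with hy
    have hTy : T (T y) - (r + s) • T y + (r * s) • y = 0 := by
      simp only [hy, map_sub, map_smul, hw, smul_zero, sub_zero, smul_sub, smul_smul]
      rw [mul_div_cancel₀ _ (mul_ne_zero hr hs), ← add_sub_assoc, ht, sub_self]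
    have hx : x = (r - s)⁻¹ • (T y - s • y) + (r - s)⁻¹ • (r • y - T y)
        + (t / (r * s)) • w := by
      have : T y - s • y + (r • y - T y) = (r - s) • y := by module
      rw [← smul_add, this, smul_smul, inv_mul_cancel₀ h1, one_smul, hy, sub_add_cancel]
    rw [hx]
    refine Submodule.add_mem_sup (Submodule.add_mem_sup ?_ ?_)
      (Submodule.smul_mem _ _ (Submodule.mem_span_singleton_self _))
    · refine Submodule.smul_mem _ _ (Module.End.mem_eigenspace_iff.mpr ?_)
      rw [← sub_eq_zero, ← hTy, map_sub, map_smul]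
      module
    · refine Submodule.smul_mem _ _ (Module.End.mem_eigenspace_iff.mpr ?_)
      rw [← sub_eq_zero, ← neg_eq_zero, ← hTy, map_sub, map_smul]
      module
  have h1 := Submodule.finrank_add_le_finrank_add_finrank (T.eigenspace r ⊔ T.eigenspace s) (F ∙ w)
  have h2 := Submodule.finrank_add_le_finrank_add_finrank (T.eigenspace r) (T.eigenspace s)
  have h3 := finrank_span_le_card (R := F) ({w} : Set M)
  rw [Set.toFinset_singleton, Finset.card_singleton] at h3
  rw [htop, finrank_top] at h1
  omega

/-- If `S B = d - m u wᵀ` with `S` diagonal and `d` of `p`-adic valuation `a`, then at most one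
diagonal entry of `S` is divisible by `p ^ (a + 1)`. -/
lemma eq_of_pow_succ_dvd_diag {n : Type*} [Fintype n] [DecidableEq n] {S B : Matrix n n ℤ}
    (hdiag : ∀ i j, i ≠ j → S i j = 0) {d m : ℤ} {u w : n → ℤ}
    (hSB : S * B = d • 1 - m • Matrix.vecMulVec u w) {p : ℤ} (hp : Prime p) {a : ℕ}
    (hda : p ^ a ∣ d) (hd : ¬ p ^ (a + 1) ∣ d) {i j : n}
    (hi : p ^ (a + 1) ∣ S i i) (hj : p ^ (a + 1) ∣ S j j) : i = j := by
  by_contra hij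
  have hdvd : ∀ x y, p ^ (a + 1) ∣ S x x → p ^ (a + 1) ∣ (S * B) x y := fun x y hx => by
    rw [Matrix.mul_apply, Finset.sum_eq_single x (fun b _ hb => by simp [hdiag x b hb.symm])
      (by simp)]
    exact hx.mul_right _
  have hii := hdvd i i hi
  have hi_j := hdvd i j hi
  have hj_i := hdvd j i hj
  have hjj := hdvd j j hj
  simp only [hSB, Matrix.sub_apply, Matrix.smul_apply, Matrix.vecMulVec_apply, Matrix.one_apply_eq,
    Matrix.one_apply_ne hij, Matrix.one_apply_ne (Ne.symm hij), smul_eq_mul, mul_zero, mul_one,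
    zero_sub, dvd_neg] at hii hi_j hj_i hjj
  have h1 : ¬ p ^ (a + 1) ∣ m * (u i * w i) := fun h => hd ((dvd_sub_left h).mp hii)
  have h2 : ¬ p ^ (a + 1) ∣ m * (u j * w j) := fun h => hd ((dvd_sub_left h).mp hjj)
  have hprod : p ^ (a + a + 1) ∣ (m * (u i * w i)) * (m * (u j * w j)) := by
    have : (m * (u i * w i)) * (m * (u j * w j)) = (m * (u i * w j)) * (m * (u j * w i)) := by ring
    rw [this]
    exact (pow_dvd_pow p (by omega)).trans (pow_add p (a + 1) (a + 1) ▸ mul_dvd_mul hi_j hj_i)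
  have hle : p ^ a ∣ p ^ (a + 1) := pow_dvd_pow p a.le_succ
  exact (succ_dvd_or_succ_dvd_of_succ_sum_dvd_mul hp ((dvd_sub_right hda).mp (hle.trans hii))
    ((dvd_sub_right hda).mp (hle.trans hjj)) hprod).elim h1 h2

lemma SimpleGraph.IsSRGWith.eigenvalue_quadratic {V F : Type*} [Fintype V] [DecidableEq V]
    [Field F] {G : SimpleGraph V} [DecidableRel G.Adj] {n k l m : ℕ}
    (h : G.IsSRGWith n k l m) {r : F} (hr : r ≠ 0)
    (hre : Module.End.HasEigenvalue (Matrix.toLin' (G.lapMatrix F)) r) :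
    r * r = (2 * k - l + m) * r - (k ^ 2 - k - l * k + m + m * k) := by
  obtain ⟨x, hx⟩ := hre.exists_hasEigenvector
  have hLx : (G.lapMatrix F).mulVec x = r • x := by
    simpa using Module.End.mem_eigenspace_iff.mp hx.1
  obtain ⟨i, hi⟩ := Function.ne_iff.mp hx.2
  have hsum : ∑ j, x j = 0 := by
    have := G.sum_lapMatrix_mulVec_s7 x
    simp only [hLx, Pi.smul_apply, smul_eq_mul, ← Finset.mul_sum] at this
    exact (mul_eq_zero.mp this).resolve_left hr
  have hq := congr_fun (congr_arg (Matrix.mulVec · x) (h.lapMatrix_mul_self (R := F))) i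
  simp only [← Matrix.mulVec_mulVec, Matrix.add_mulVec, Matrix.sub_mulVec, Matrix.smul_mulVec,
    hLx, Matrix.mulVec_smul, Matrix.one_mulVec, Pi.add_apply, Pi.sub_apply, Pi.smul_apply,
    smul_eq_mul] at hq
  rw [show (Matrix.of fun _ _ => (1 : F)).mulVec x i = ∑ j, x j by
    simp [Matrix.mulVec, dotProduct], hsum] at hq
  refine mul_right_cancel₀ hi ?_
  linear_combination hq

/-- The Laplacian `L` of a strongly regular graph with nonzero eigenvalues `r ≠ s` satisfies
`(L - r) (L - s) = m J`. -/
lemma SimpleGraph.IsSRGWith.lapMatrix_mul_self_of_hasEigenvalue {V : Type*} [Fintype V]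
    [DecidableEq V] {G : SimpleGraph V} [DecidableRel G.Adj] {n k l m : ℕ}
    (h : G.IsSRGWith n k l m) {r s : ℤ} (hrs : r ≠ s) (hr0 : r ≠ 0) (hs0 : s ≠ 0)
    (hre : Module.End.HasEigenvalue (Matrix.toLin' (G.lapMatrix ℚ)) (r : ℚ))
    (hse : Module.End.HasEigenvalue (Matrix.toLin' (G.lapMatrix ℚ)) (s : ℚ))
    (R : Type*) [CommRing R] :
    G.lapMatrix R * G.lapMatrix R =
      (r + s : R) • G.lapMatrix R - (r * s : R) • 1 + (m : R) • Matrix.of fun _ _ => 1 := by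
  have hr := h.eigenvalue_quadratic (Int.cast_ne_zero.mpr hr0) hre
  have hs := h.eigenvalue_quadratic (Int.cast_ne_zero.mpr hs0) hse
  have hr' : r * r = (2 * k - l + m) * r - (k ^ 2 - k - l * k + m + m * k) := by exact_mod_cast hr
  have hs' : s * s = (2 * k - l + m) * s - (k ^ 2 - k - l * k + m + m * k) := by exact_mod_cast hs
  have hc : (2 * k - l + m : ℤ) = r + s := by
    refine mul_left_cancel₀ (sub_ne_zero.mpr hrs) ?_
    linear_combination hs' - hr'
  have hd : (k ^ 2 - k - l * k + m + m * k : ℤ) = r * s := by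
    linear_combination hr' + r * hc
  have hcR := congr_arg (Int.cast (R := R)) hc
  have hdR := congr_arg (Int.cast (R := R)) hd
  push_cast at hcR hdR
  rw [h.lapMatrix_mul_self, hcR, hdR]

lemma SimpleGraph.map_lapMatrix {V R S : Type*} [Fintype V] [DecidableEq V] [CommRing R]
    [CommRing S] (G : SimpleGraph V) [DecidableRel G.Adj] (f : R →+* S) :
    (G.lapMatrix R).map f = G.lapMatrix S := by
  ext i j
  simp [lapMatrix, degMatrix, Matrix.diagonal_apply, adjMatrix_apply, apply_ite f]

/-- An integer vector lying in a rational eigenspace is an integral eigenvector. -/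
lemma SimpleGraph.lapMatrix_mulVec_of_cast_mem_eigenspace {V : Type*} [Fintype V] [DecidableEq V]
    (G : SimpleGraph V) [DecidableRel G.Adj] {r : ℤ} {x : V → ℤ}
    (hx : (fun i => (x i : ℚ)) ∈
      Module.End.eigenspace (Matrix.toLin' (G.lapMatrix ℚ)) (r : ℚ)) :
    (G.lapMatrix ℤ).mulVec x = r • x := by
  rw [Module.End.mem_eigenspace_iff, Matrix.toLin'_apply,
    ← G.map_lapMatrix (Int.castRingHom ℚ)] at hx
  ext i
  have hi := congr_fun hx i
  simp only [Matrix.mulVec, dotProduct, Matrix.map_apply, eq_intCast, Pi.smul_apply,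
    smul_eq_mul] at hi ⊢
  exact_mod_cast hi

/-- Let `Γ` be a connected strongly regular graph with parameters
`(v, k, l, m)` whose nonzero Laplacian eigenvalues `r`, `s` are integers with multiplicities
`f`, `g`, and let `p` be a prime dividing `|K(Γ)|` with `p ∤ r` and `p^a ∥ s`, `a ≥ 1`.
If `e j` denotes the multiplicity of `p^j` as an elementary divisor of the Laplacian
(read off from a Smith normal form `S = U * L * W`), then `g - 1 ≤ e a ≤ g`. -/
theorem elementaryDivisor_multiplicity_bounds {v : ℕ}
    (G : SimpleGraph (Fin v)) [DecidableRel G.Adj]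
    (k l m f g : ℕ) (hsrg : G.IsSRGWith v k l m) (hconn : G.Connected)
    (r s : ℤ) (hrs : r ≠ s) (hr0 : r ≠ 0) (hs0 : s ≠ 0)
    (hre : Module.End.HasEigenvalue (Matrix.toLin' (G.lapMatrix ℚ)) (r : ℚ))
    (hse : Module.End.HasEigenvalue (Matrix.toLin' (G.lapMatrix ℚ)) (s : ℚ))
    (hf : Module.finrank ℚ (Module.End.eigenspace (Matrix.toLin' (G.lapMatrix ℚ)) (r : ℚ)) = f)
    (hg : Module.finrank ℚ (Module.End.eigenspace (Matrix.toLin' (G.lapMatrix ℚ)) (s : ℚ)) = g)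
    (p : ℕ) (hp : p.Prime) (hpK : p ∣ Nat.card ↥(criticalGroup G))
    (hpr : ¬ (p : ℤ) ∣ r)
    (a : ℕ) (ha1 : 1 ≤ a)
    (ha : (p : ℤ) ^ a ∣ s ∧ ¬ (p : ℤ) ^ (a + 1) ∣ s)
    (U W S : Matrix (Fin v) (Fin v) ℤ)
    (hU : IsUnit U.det) (hW : IsUnit W.det)
    (hS : U * G.lapMatrix ℤ * W = S)
    (hdiag : ∀ i j : Fin v, i ≠ j → S i j = 0)
    (hdvd : ∀ i j : Fin v, i ≤ j → S i i ∣ S j j)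
    (e : ℕ → ℕ)
    (he : ∀ j : ℕ,
      e j = Nat.card {i : Fin v // (p : ℤ) ^ j ∣ S i i ∧ ¬ (p : ℤ) ^ (j + 1) ∣ S i i}) :
    g - 1 ≤ e a ∧ e a ≤ g := by
  classical
  subst hf hg
  have hpZ : Prime (p : ℤ) := Nat.prime_iff_prime_int.mp hp
  have : Nonempty (Fin v) := hconn.nonempty
  obtain ⟨has, has'⟩ := ha
  have hpr' : ∀ n, (p : ℤ) ^ n ∣ r * s → (p : ℤ) ^ n ∣ s := fun n h =>
    hpZ.pow_dvd_of_dvd_mul_left n hpr h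
  have hUU : U * U⁻¹ = 1 := Matrix.mul_nonsing_inv U hU
  have hWW : W⁻¹ * W = 1 := Matrix.nonsing_inv_mul W hW
  have hWW' : W * W⁻¹ = 1 := Matrix.mul_nonsing_inv W hW
  have hSmul : ∀ y i, S.mulVec y i = S i i * y i := fun y i => by
    rw [Matrix.mulVec, dotProduct, Finset.sum_eq_single i
      (fun j _ hj => by rw [hdiag i j hj.symm, zero_mul]) (by simp)]
  have hSW : ∀ x, S.mulVec (W⁻¹.mulVec x) = U.mulVec ((G.lapMatrix ℤ).mulVec x) := fun x => by
    rw [← hS, Matrix.mulVec_mulVec, Matrix.mul_assoc, hWW', Matrix.mul_one, Matrix.mulVec_mulVec]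
  -- The `s`-eigenspace bounds the number of entries divisible by `p ^ a` from below.
  have hg_le := finrank_le_card_of_forall_dvd hpZ.not_isUnit
    (Module.End.eigenspace (Matrix.toLin' (G.lapMatrix ℚ)) (s : ℚ))
    {i | (p : ℤ) ^ a ∣ S i i} hWW fun x hx hK i => by
      by_cases hi : (p : ℤ) ^ a ∣ S i i
      · rw [hK i (by simpa using hi)]
        exact dvd_zero _
      · have h1 : (p : ℤ) ^ a ∣ S i i * W⁻¹.mulVec x i := by
          rw [← hSmul, hSW, G.lapMatrix_mulVec_of_cast_mem_eigenspace hx, Matrix.mulVec_smul]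
          exact has.mul_right _
        by_contra hpx
        exact hi (hpZ.pow_dvd_of_dvd_mul_right a hpx h1)
  -- The `r`-eigenspace bounds the number of entries prime to `p` from below.
  have hf_le := finrank_le_card_of_forall_dvd hpZ.not_isUnit
    (Module.End.eigenspace (Matrix.toLin' (G.lapMatrix ℚ)) (r : ℚ))
    {i | ¬ (p : ℤ) ∣ S i i} hUU fun x hx hK i => by
      by_cases hi : (p : ℤ) ∣ S i i
      · have h1 : r * U.mulVec x i = S i i * W⁻¹.mulVec x i := by
          rw [← hSmul, hSW, G.lapMatrix_mulVec_of_cast_mem_eigenspace hx, Matrix.mulVec_smul]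
          rfl
        exact (hpZ.dvd_or_dvd (h1 ▸ hi.mul_right _)).resolve_left hpr
      · rw [hK i (by simpa using hi)]
        exact dvd_zero _
  have hquadQ := hsrg.lapMatrix_mul_self_of_hasEigenvalue hrs hr0 hs0 hre hse ℚ
  have hquadZ := hsrg.lapMatrix_mul_self_of_hasEigenvalue hrs hr0 hs0 hre hse ℤ
  have hv := finrank_le_finrank_eigenspace_add (Matrix.toLin' (G.lapMatrix ℚ))
    (Int.cast_injective.ne hrs : (r : ℚ) ≠ s) (Int.cast_ne_zero.mpr hr0)
    (Int.cast_ne_zero.mpr hs0) (w := fun _ => 1)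
    (by rw [Matrix.toLin'_apply, G.lapMatrix_mulVec_const_eq_zero]) fun x => by
      refine ⟨m * ∑ i, x i, ?_⟩
      simp only [Matrix.toLin'_apply, Matrix.mulVec_mulVec, hquadQ, Matrix.add_mulVec,
        Matrix.sub_mulVec, Matrix.smul_mulVec, Matrix.one_mulVec]
      ext i
      simp [Matrix.mulVec, dotProduct]
      ring
  rw [Module.finrank_fin_fun] at hv
  -- At most one entry is divisible by `p ^ (a + 1)`.
  have hSB : S * (W⁻¹ * ((r + s) • 1 - G.lapMatrix ℤ) * U⁻¹) = (r * s) • 1 -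
      (m : ℤ) • Matrix.vecMulVec (U.mulVec fun _ => 1) (U⁻¹.vecMul fun _ => 1) := by
    have hJ : (Matrix.of fun _ _ => 1 : Matrix (Fin v) (Fin v) ℤ) =
        Matrix.vecMulVec (fun _ => 1) (fun _ => 1) := by
      ext i j
      simp [Matrix.vecMulVec_apply]
    have hL : G.lapMatrix ℤ * ((r + s) • 1 - G.lapMatrix ℤ) =
        (r * s) • 1 - (m : ℤ) • Matrix.vecMulVec (fun _ => 1) (fun _ => 1) := by
      rw [mul_sub, hquadZ, hJ, Matrix.mul_smul, Matrix.mul_one, Int.cast_id, Int.cast_id]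
      abel
    calc S * (W⁻¹ * ((r + s) • 1 - G.lapMatrix ℤ) * U⁻¹)
        = U * (G.lapMatrix ℤ * (W * W⁻¹) * ((r + s) • 1 - G.lapMatrix ℤ)) * U⁻¹ := by
          simp only [← hS, Matrix.mul_assoc]
      _ = _ := by
          rw [hWW', Matrix.mul_one, hL, mul_sub, sub_mul, Matrix.mul_smul, Matrix.mul_smul,
            Matrix.smul_mul, Matrix.smul_mul, Matrix.mul_one, hUU, Matrix.mul_vecMulVec,
            Matrix.vecMulVec_mul]
  have hone : ({i | (p : ℤ) ^ (a + 1) ∣ S i i} : Finset (Fin v)).card ≤ 1 :=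
    Finset.card_le_one.mpr fun i hi j hj =>
      eq_of_pow_succ_dvd_diag hdiag hSB hpZ (has.mul_left r) (fun h => has' (hpr' _ h))
        (by simpa using hi) (by simpa using hj)
  -- Some entry vanishes, since the Laplacian is singular.
  obtain ⟨i₀, hi₀⟩ : ∃ i, S i i = 0 := by
    have hLdet : (G.lapMatrix ℤ).det = 0 :=
      Matrix.exists_mulVec_eq_zero_iff.mp
        ⟨fun _ => 1, Function.ne_iff.mpr ⟨Classical.arbitrary _, one_ne_zero⟩,
          G.lapMatrix_mulVec_const_eq_zero⟩
    have hSdet : S.det = 0 := by rw [← hS, Matrix.det_mul, Matrix.det_mul, hLdet]; simp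
    have hSd : S = Matrix.diagonal fun i => S i i := by
      ext i j
      by_cases hij : i = j
      · simp [hij]
      · simp [hij, hdiag i j hij]
    rw [hSd, Matrix.det_diagonal, Finset.prod_eq_zero_iff] at hSdet
    simpa using hSdet
  have hpos : 0 < ({i | (p : ℤ) ^ (a + 1) ∣ S i i} : Finset (Fin v)).card :=
    Finset.card_pos.mpr ⟨i₀, by simp [hi₀]⟩
  have hea : e a + ({i | (p : ℤ) ^ (a + 1) ∣ S i i} : Finset (Fin v)).card =
      ({i | (p : ℤ) ^ a ∣ S i i} : Finset (Fin v)).card := by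
    rw [he, Nat.card_eq_fintype_card, Fintype.card_subtype, ← Finset.card_union_of_disjoint]
    · congr 1
      ext i
      have : (p : ℤ) ^ (a + 1) ∣ S i i → (p : ℤ) ^ a ∣ S i i := (pow_dvd_pow _ a.le_succ).trans
      simp only [Finset.mem_union, Finset.mem_filter_univ]
      tauto
    · exact Finset.disjoint_filter.mpr fun i _ h => h.2
  have hle : ({i | (p : ℤ) ^ a ∣ S i i} : Finset (Fin v)).card ≤
      ({i | (p : ℤ) ∣ S i i} : Finset (Fin v)).card :=
    Finset.card_le_card fun i hi => by
      simp only [Finset.mem_filter_univ] at hi ⊢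
      exact (dvd_pow_self _ (by omega)).trans hi
  have hsplit := Finset.card_filter_add_card_filter_not (s := (Finset.univ : Finset (Fin v)))
    fun i => (p : ℤ) ∣ S i i
  rw [Finset.card_univ, Fintype.card_fin] at hsplit
  omega
end

section
/- If Γ is a connected strongly regular graph with parameters (99, 14, 1, 2), then its critical group satisfies K(Γ) ≅ (Z/11Z)^53 ⊕ (Z/2Z)^44 ⊕ (Z/9Z)^43. -/
open SimpleGraph

open scoped Matrix

namespace Matrix

variable {V : Type*} [Fintype V]

theorem rank_map_intCast_zmod_le (p : ℕ) [Fact p.Prime] (B : Matrix V V ℤ) :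
    (B.map (Int.cast : ℤ → ZMod p)).rank ≤ (B.map (Int.cast : ℤ → ℚ)).rank := by
  obtain ⟨κ, a, ha, hspan, hli⟩ :=
    exists_linearIndependent' (ZMod p) (B.map (Int.cast : ℤ → ZMod p)).col
  have : Finite κ := Finite.of_injective a ha
  have : Fintype κ := Fintype.ofFinite κ
  have hdvd (N : ℕ) : ∀ g : κ → ℤ, (∀ i, ∑ k, g k * B i (a k) = 0) → ∀ k, (p : ℤ) ^ N ∣ g k := by
    induction N with
    | zero => simp
    | succ N ih =>
      intro g hg
      have hmod : ∀ k, (p : ℤ) ∣ g k := by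
        intro k
        rw [← ZMod.intCast_zmod_eq_zero_iff_dvd]
        refine Fintype.linearIndependent_iff.1 hli (fun k => (g k : ZMod p)) ?_ k
        ext i
        simpa [Finset.sum_apply] using congrArg (Int.cast : ℤ → ZMod p) (hg i)
      choose c hc using hmod
      have hp : (p : ℤ) ≠ 0 := by exact_mod_cast (Fact.out : p.Prime).ne_zero
      have hcrel (i : V) : ∑ k, c k * B i (a k) = 0 := by
        apply mul_left_cancel₀ hp
        simpa [Finset.mul_sum, hc, mul_assoc] using hg i
      intro k
      rw [hc k, pow_succ']
      exact mul_dvd_mul_left _ (ih c hcrel k)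
  have hliℚ : LinearIndependent ℚ ((B.map (Int.cast : ℤ → ℚ)).col ∘ a) := by
    rw [← LinearIndependent.iff_fractionRing ℤ ℚ, Fintype.linearIndependent_iff]
    intro g hg k
    have hrel (i : V) : ∑ k, g k * B i (a k) = 0 := by
      have : ∑ k, (g k : ℚ) * B i (a k) = 0 := by
        simpa [Finset.sum_apply] using congrFun hg i
      exact_mod_cast this
    by_contra hk
    have hlt : (g k).natAbs < p ^ (g k).natAbs :=
      Nat.lt_pow_self (Fact.out : p.Prime).one_lt
    have := Int.natAbs_dvd_natAbs.2 (hdvd (g k).natAbs g hrel k)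
    rw [Int.natAbs_pow, Int.natAbs_natCast] at this
    exact absurd (Nat.le_of_dvd (Int.natAbs_pos.2 hk) this) (by lia)
  rw [rank_eq_finrank_span_cols, rank_eq_finrank_span_cols, ← hspan,
    finrank_span_eq_card hli, ← finrank_span_eq_card hliℚ]
  exact Submodule.finrank_mono (Submodule.span_mono (Set.range_comp_subset_range _ _))

variable [DecidableEq V]

theorem trace_eq_mul_rank_of_mul_self_eq_smul {K : Type*} [Field K] {B : Matrix V V K}
    {c : K} (hc : c ≠ 0) (hB : B * B = c • B) : B.trace = c * B.rank := by
  have hE : IsIdempotentElem (toLin' (c⁻¹ • B)) := by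
    rw [IsIdempotentElem, Module.End.mul_eq_comp, ← toLin'_mul, smul_mul_smul_comm, hB, smul_smul]
    congr 2
    field_simp
  have htr := (LinearMap.IsIdempotentElem.isProj_range _ hE).trace
  have hrank : Module.finrank K (LinearMap.range (toLin' (c⁻¹ • B))) = B.rank := by
    rw [map_smul, LinearMap.range_smul _ _ (inv_ne_zero hc)]
    rfl
  rw [hrank, trace_toLin'_eq, trace_smul, smul_eq_mul] at htr
  rw [← htr, mul_inv_cancel_left₀ hc]

theorem card_le_rank_add_rank_smul_one_sub {K : Type*} [Field K] (B : Matrix V V K)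
    {c : K} (hc : c ≠ 0) : Fintype.card V ≤ B.rank + (c • 1 - B).rank := by
  have hker : LinearMap.ker B.mulVecLin ≤ LinearMap.range (c • 1 - B).mulVecLin := by
    intro x hx
    refine ⟨c⁻¹ • x, ?_⟩
    rw [LinearMap.mem_ker, mulVecLin_apply] at hx
    simp [hx, hc]
  have h := B.mulVecLin.finrank_range_add_finrank_ker
  rw [Module.finrank_fintype_fun_eq_card] at h
  have := Submodule.finrank_mono hker
  simp only [rank] at *
  lia

/-- The reduction modulo `p` of a multiple of a rational idempotent has the rank predicted by its
trace, provided that the multiple is prime to `p`. -/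
theorem rank_map_intCast_zmod_of_mul_self_eq_smul (p : ℕ) [Fact p.Prime] {B : Matrix V V ℤ}
    {c : ℤ} {r : ℕ} (hc : (c : ZMod p) ≠ 0) (hB : B * B = c • B) (htr : B.trace = c * r) :
    (B.map (Int.cast : ℤ → ZMod p)).rank = r := by
  have hc0 : c ≠ 0 := by rintro rfl; simp at hc
  have hcℚ : (c : ℚ) ≠ 0 := by exact_mod_cast hc0
  have hrank (A : Matrix V V ℤ) (s : ℤ) (hA : A * A = c • A) (hs : A.trace = c * s) :
      ((A.map (Int.cast : ℤ → ℚ)).rank : ℤ) = s := by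
    have hAℚ : A.map (Int.cast : ℤ → ℚ) * A.map (Int.cast : ℤ → ℚ) =
        (c : ℚ) • A.map (Int.cast : ℤ → ℚ) := by
      have := congrArg (Int.castRingHom ℚ).mapMatrix hA
      rw [map_mul] at this
      refine this.trans ?_
      ext i j
      simp [-zsmul_eq_mul]
    have h := trace_eq_mul_rank_of_mul_self_eq_smul hcℚ hAℚ
    have htrace : (A.map (Int.cast : ℤ → ℚ)).trace = (A.trace : ℚ) := by
      simp [trace]
    rw [htrace, hs, Int.cast_mul] at h
    exact_mod_cast (mul_left_cancel₀ hcℚ h).symm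
  have hB' : (c • 1 - B) * (c • 1 - B) = c • (c • 1 - B) := by
    simp only [sub_mul, mul_sub, hB, smul_mul_assoc, mul_smul_comm, one_mul, mul_one, smul_sub]
    abel
  have htr' : (c • 1 - B).trace = c * ((Fintype.card V : ℤ) - r) := by
    rw [trace_sub, trace_smul, trace_one, htr, smul_eq_mul]
    ring
  have h₁ := hrank B r hB htr
  have h₂ := hrank (c • 1 - B) _ hB' htr'
  have h₃ := rank_map_intCast_zmod_le p B
  have h₄ := rank_map_intCast_zmod_le p (c • 1 - B)
  have h₅ := card_le_rank_add_rank_smul_one_sub (B.map (Int.cast : ℤ → ZMod p)) hc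
  have h₆ : (c • 1 - B).map (Int.cast : ℤ → ZMod p) =
      (c : ZMod p) • 1 - B.map (Int.cast : ℤ → ZMod p) := by
    ext i j
    by_cases hij : i = j <;> simp [hij, -zsmul_eq_mul, -zsmul_one]
  rw [h₆] at h₄
  lia

theorem rank_eq_rank_mul_self_add_one {K : Type*} [Field K] [Nonempty V] {B : Matrix V V K}
    {a b : K} (hb : b ≠ 0) (hB : B = a • (B * B) + b • of fun _ _ => 1)
    (hker : B *ᵥ 1 = 0) : B.rank = (B * B).rank + 1 := by
  have hBx (x : V → K) : B *ᵥ x = a • (B *ᵥ (B *ᵥ x)) + (b * ∑ i, x i) • 1 := by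
    conv_lhs => rw [hB]
    rw [add_mulVec, smul_mulVec, smul_mulVec, ← mulVec_mulVec]
    congr 1
    ext i
    simp [mulVec, dotProduct]
  have hrange : LinearMap.range B.mulVecLin =
      LinearMap.range (B * B).mulVecLin ⊔ Submodule.span K {(1 : V → K)} := by
    apply le_antisymm
    · rintro _ ⟨x, rfl⟩
      rw [mulVecLin_apply, hBx]
      refine Submodule.add_mem_sup ⟨a • x, ?_⟩
        (Submodule.smul_mem _ _ (Submodule.mem_span_singleton_self _))
      simp
    · refine sup_le ?_ ?_
      · rintro _ ⟨x, rfl⟩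
        exact ⟨B *ᵥ x, by simp⟩
      · rw [Submodule.span_singleton_le_iff_mem]
        let x : V → K := Pi.single (Classical.arbitrary V) 1
        refine ⟨b⁻¹ • (x - a • (B *ᵥ x)), ?_⟩
        have h := hBx x
        have hx : ∑ i, x i = 1 := by simp [x]
        rw [hx, mul_one] at h
        rw [mulVecLin_apply, mulVec_smul, mulVec_sub, mulVec_smul, inv_smul_eq_iff₀ hb,
          sub_eq_iff_eq_add']
        exact h
  have hdisj : LinearMap.range (B * B).mulVecLin ⊓ Submodule.span K {(1 : V → K)} = ⊥ := by
    rw [eq_bot_iff]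
    rintro y ⟨⟨x, rfl⟩, hy⟩
    obtain ⟨t, ht⟩ := Submodule.mem_span_singleton.1 hy
    rw [mulVecLin_apply, ← mulVec_mulVec] at ht ⊢
    have hcol : ∑ i, (B *ᵥ x) i = 0 := by
      have h := congrArg (B *ᵥ ·) (hBx x)
      have h' := hBx (B *ᵥ x)
      simp only [mulVec_add, mulVec_smul, hker, smul_zero, add_zero] at h
      have := add_eq_left.1 (h'.symm.trans h)
      obtain ⟨i⟩ := ‹Nonempty V›
      simpa [hb] using congrFun this i
    rw [Submodule.mem_bot, hBx, hcol, ← ht, mulVec_smul, hker]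
    simp
  have hone : (1 : V → K) ≠ 0 := one_ne_zero
  have h := Submodule.finrank_sup_add_finrank_inf_eq (LinearMap.range (B * B).mulVecLin)
    (Submodule.span K {(1 : V → K)})
  rw [hdisj, ← hrange, finrank_bot, finrank_span_singleton hone, add_zero] at h
  exact h

end Matrix

/-- A `ZMod (p ^ 2)`-module in which every element of order `p` is divisible by `p` is free, of the
same rank as its reduction modulo `p`. -/
theorem nonempty_addEquiv_pi_zmod_sq (p d : ℕ) [Fact p.Prime] {A : Type*} [AddCommGroup A]
    [Module (ZMod (p ^ 2)) A] (φ : A →+ (Fin d → ZMod p)) (hφ : Function.Surjective φ)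
    (hker : ∀ x, φ x = 0 → ∃ y, x = p • y) (hdiv : ∀ x : A, p • x = 0 → ∃ y, x = p • y) :
    Nonempty (A ≃+ (Fin d → ZMod (p ^ 2))) := by
  have hA (x : A) : p ^ 2 • x = 0 := ZModModule.char_nsmul_eq_zero (p ^ 2) x
  have : NeZero (p ^ 2) := ⟨pow_ne_zero 2 (Fact.out : p.Prime).ne_zero⟩
  have hval (c : ZMod (p ^ 2)) (x : A) : c • x = c.val • x := by
    rw [← Nat.cast_smul_eq_nsmul (ZMod (p ^ 2)), ZMod.natCast_zmod_val]
  choose a ha using fun i : Fin d => hφ (Pi.single i 1)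
  have hcomb (n : Fin d → ℕ) : φ (∑ i, n i • a i) = fun i => (n i : ZMod p) := by
    ext j
    simp [ha, Pi.single_apply, Finset.sum_apply]
  let g : (Fin d → ZMod (p ^ 2)) →ₗ[ZMod (p ^ 2)] A := Fintype.linearCombination _ a
  have hg (c : Fin d → ZMod (p ^ 2)) : g c = ∑ i, (c i).val • a i := by
    simp [g, Fintype.linearCombination_apply, hval]
  have hzero (n : Fin d → ℕ) (hn : ∑ i, n i • a i = 0) (i : Fin d) : p ∣ n i := by
    have h := hcomb n
    rw [hn, map_zero] at h
    rw [← ZMod.natCast_eq_zero_iff]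
    exact (congrFun h i).symm
  have hinj : Function.Injective g := by
    rw [injective_iff_map_eq_zero]
    intro c hc
    rw [hg] at hc
    choose m hm using hzero _ hc
    have hpm : p • ∑ i, m i • a i = 0 := by
      rw [← hc, Finset.smul_sum]
      simp only [hm, mul_nsmul']
    obtain ⟨y, hy⟩ := hdiv _ hpm
    have hφm : φ (∑ i, m i • a i) = 0 := by
      rw [hy, map_nsmul]
      ext
      simp
    ext i
    have hmi : p ∣ m i := by
      rw [← ZMod.natCast_eq_zero_iff, ← congrFun (hcomb m) i, hφm]
      rfl
    have hdvd : p ^ 2 ∣ (c i).val := by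
      rw [hm i, sq]
      exact mul_dvd_mul_left p hmi
    rw [Pi.zero_apply, ← ZMod.natCast_zmod_val (c i), ZMod.natCast_eq_zero_iff]
    exact hdvd
  have happrox (x : A) : ∃ c y, x = g c + p • y := by
    let n : Fin d → ℕ := fun i => (φ x i).val
    obtain ⟨y, hy⟩ := hker (x - ∑ i, n i • a i) (by
      rw [map_sub, hcomb, sub_eq_zero]
      ext i
      simp [n])
    refine ⟨fun i => n i, y, ?_⟩
    rw [← hy]
    simp [g, Fintype.linearCombination_apply, Nat.cast_smul_eq_nsmul]
  have hsurj : Function.Surjective g := by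
    intro x
    obtain ⟨c, y, rfl⟩ := happrox x
    obtain ⟨c', y', rfl⟩ := happrox y
    refine ⟨c + p • c', ?_⟩
    rw [smul_add, ← mul_nsmul', ← sq, hA, add_zero, map_add, map_nsmul]
  exact ⟨(LinearEquiv.ofBijective g ⟨hinj, hsurj⟩).toAddEquiv.symm⟩

theorem nonempty_addEquiv_of_nsmul_198_eq_zero {K A₁₁ A₂ A₃ : Type*} [AddCommGroup K]
    [AddCommGroup A₁₁] [AddCommGroup A₂] [AddCommGroup A₃] (hK : ∀ x : K, 198 • x = 0)
    (φ₁₁ : K →+ A₁₁) (φ₂ : K →+ A₂) (φ₃ : K →+ A₃)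
    (h₁₁ : Function.Surjective φ₁₁) (h₂ : Function.Surjective φ₂) (h₃ : Function.Surjective φ₃)
    (hk₁₁ : ∀ x, φ₁₁ x = 0 ↔ ∃ y, x = 11 • y) (hk₂ : ∀ x, φ₂ x = 0 ↔ ∃ y, x = 2 • y)
    (hk₃ : ∀ x, φ₃ x = 0 ↔ ∃ y, x = 9 • y) :
    Nonempty (K ≃+ A₁₁ × A₂ × A₃) := by
  refine ⟨AddEquiv.ofBijective (φ₁₁.prod (φ₂.prod φ₃)) ⟨?_, ?_⟩⟩
  · rw [injective_iff_map_eq_zero]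
    intro x hx
    simp only [AddMonoidHom.prod_apply, Prod.mk_eq_zero] at hx
    obtain ⟨a, ha⟩ := (hk₁₁ x).1 hx.1
    obtain ⟨b, hb⟩ := (hk₂ x).1 hx.2.1
    obtain ⟨c, hc⟩ := (hk₃ x).1 hx.2.2
    have hxa : 18 • x = 0 := by rw [ha, ← mul_nsmul', hK]
    have hxb : 99 • x = 0 := by rw [hb, ← mul_nsmul', hK]
    have hxc : 22 • x = 0 := by rw [hc, ← mul_nsmul', hK]
    calc x = 8 • (18 • x) + 99 • x + 7 • (22 • x) - 2 • (198 • x) := by module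
      _ = 0 := by simp [hxa, hxb, hxc, hK]
  · rintro ⟨u, v, w⟩
    obtain ⟨a, rfl⟩ := h₁₁ u
    obtain ⟨b, rfl⟩ := h₂ v
    obtain ⟨c, rfl⟩ := h₃ w
    refine ⟨144 • a + 99 • b + 154 • c, ?_⟩
    simp only [AddMonoidHom.prod_apply, Prod.mk.injEq]
    refine ⟨?_, ?_, ?_⟩ <;> rw [← sub_eq_zero, ← map_sub]
    · exact (hk₁₁ _).2 ⟨13 • a + 9 • b + 14 • c, by module⟩
    · exact (hk₂ _).2 ⟨72 • a + 49 • b + 77 • c, by module⟩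
    · exact (hk₃ _).2 ⟨16 • a + 11 • b + 17 • c, by module⟩

/-- An abelian group killed by `198` is determined by its reductions modulo `2`, `3` and `11`, if
its elements of order `3` are divisible by `3`. -/
theorem nonempty_addEquiv_of_reductions {K : Type*} [AddCommGroup K] (hK : ∀ x : K, 198 • x = 0)
    {a b c : ℕ} (φ₁₁ : K →+ (Fin a → ZMod 11)) (φ₂ : K →+ (Fin b → ZMod 2))
    (φ₃ : K →+ (Fin c → ZMod 3))
    (h₁₁ : Function.Surjective φ₁₁) (h₂ : Function.Surjective φ₂) (h₃ : Function.Surjective φ₃)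
    (hk₁₁ : ∀ x, φ₁₁ x = 0 → ∃ y, x = 11 • y) (hk₂ : ∀ x, φ₂ x = 0 → ∃ y, x = 2 • y)
    (hk₃ : ∀ x, φ₃ x = 0 → ∃ y, x = 3 • y) (hdiv : ∀ x : K, 3 • x = 0 → ∃ y, x = 3 • y) :
    Nonempty (K ≃+ (Fin a → ZMod 11) × (Fin b → ZMod 2) × (Fin c → ZMod 9)) := by
  have hφ₃ (x : K) : φ₃ (3 • x) = 0 := by
    rw [map_nsmul]
    exact funext fun i => ZModModule.char_nsmul_eq_zero 3 _
  let N : AddSubgroup K := (nsmulAddMonoidHom (α := K) 9).range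
  have hN (x : K) : x ∈ N ↔ ∃ y, x = 9 • y := by
    simp [N, eq_comm]
  have hNφ : ∀ x ∈ N, φ₃ x = 0 := by
    intro x hx
    obtain ⟨y, rfl⟩ := (hN x).1 hx
    rw [show 9 • y = 3 • (3 • y) by module]
    exact hφ₃ _
  have hquot : Nonempty ((K ⧸ N) ≃+ (Fin c → ZMod (3 ^ 2))) := by
    have h₉ (x : K ⧸ N) : 3 ^ 2 • x = 0 := by
      induction x using QuotientAddGroup.induction_on with | H x =>
      rw [← QuotientAddGroup.mk_nsmul, QuotientAddGroup.eq_zero_iff]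
      exact (hN _).2 ⟨x, rfl⟩
    let : Module (ZMod (3 ^ 2)) (K ⧸ N) := AddCommGroup.zmodModule h₉
    refine nonempty_addEquiv_pi_zmod_sq 3 c (QuotientAddGroup.lift N φ₃ hNφ) ?_ ?_ ?_
    · intro u
      obtain ⟨x, rfl⟩ := h₃ u
      exact ⟨(x : K ⧸ N), rfl⟩
    · intro x hx
      induction x using QuotientAddGroup.induction_on with | H x =>
      obtain ⟨y, rfl⟩ := hk₃ x hx
      exact ⟨(y : K ⧸ N), rfl⟩
    · intro x hx
      induction x using QuotientAddGroup.induction_on with | H x =>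
      rw [← QuotientAddGroup.mk_nsmul, QuotientAddGroup.eq_zero_iff] at hx
      obtain ⟨y, hy⟩ := (hN _).1 hx
      obtain ⟨z, hz⟩ := hdiv (x - 3 • y) (by
        rw [smul_sub, hy]
        module)
      refine ⟨((y + z : K) : K ⧸ N), ?_⟩
      rw [← QuotientAddGroup.mk_nsmul, smul_add, ← hz, add_sub_cancel]
  obtain ⟨e⟩ := hquot
  refine nonempty_addEquiv_of_nsmul_198_eq_zero hK φ₁₁ φ₂
    (e.toAddMonoidHom.comp (QuotientAddGroup.mk' N)) h₁₁ h₂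
    (e.surjective.comp (QuotientAddGroup.mk'_surjective N)) ?_ ?_ ?_
  · refine fun x => ⟨hk₁₁ x, ?_⟩
    rintro ⟨y, rfl⟩
    rw [map_nsmul]
    exact funext fun i => ZModModule.char_nsmul_eq_zero 11 _
  · refine fun x => ⟨hk₂ x, ?_⟩
    rintro ⟨y, rfl⟩
    rw [map_nsmul]
    exact funext fun i => ZModModule.char_nsmul_eq_zero 2 _
  · intro x
    rw [← hN, ← QuotientAddGroup.eq_zero_iff]
    exact e.map_eq_zero_iff

section CriticalGroup

variable {V : Type*} [Fintype V] [DecidableEq V] (G : SimpleGraph V) [DecidableRel G.Adj]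

theorem SimpleGraph.sum_lapMatrix_mulVec_s14 (x : V → ℤ) : ∑ i, (G.lapMatrix ℤ *ᵥ x) i = 0 := by
  have h : (1 : V → ℤ) ⬝ᵥ (G.lapMatrix ℤ *ᵥ x) = 0 := by
    rw [Matrix.dotProduct_mulVec, ← Matrix.mulVec_transpose, (G.isSymm_lapMatrix (R := ℤ)).eq]
    have : G.lapMatrix ℤ *ᵥ 1 = 0 := G.lapMatrix_mulVec_const_eq_zero
    rw [this, zero_dotProduct]
  simpa [dotProduct] using h

theorem sum_eq_zero_of_mem_criticalGroup {x : V → ℤ}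
    (hx : Submodule.Quotient.mk x ∈ criticalGroup G) : ∑ i, x i = 0 := by
  obtain ⟨n, hn⟩ := (Submodule.mem_torsion_iff _).1 hx
  rw [Submonoid.smul_def, ← Submodule.Quotient.mk_smul, Submodule.Quotient.mk_eq_zero] at hn
  obtain ⟨y, hy⟩ := hn
  have h := G.sum_lapMatrix_mulVec_s14 y
  rw [← Matrix.toLin'_apply, hy] at h
  simp only [Pi.smul_apply, smul_eq_mul, ← Finset.mul_sum] at h
  exact (mul_eq_zero.1 h).resolve_left (nonZeroDivisors.ne_zero n.2)

/-- The reduction modulo `p` of the critical group, computed from the rank modulo `p` of the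
Laplacian, when the critical group consists of all classes of vectors with sum zero. -/
theorem exists_criticalGroup_reduction [Nonempty V]
    (hmem : ∀ x : V → ℤ, ∑ i, x i = 0 → Submodule.Quotient.mk x ∈ criticalGroup G)
    (p d : ℕ) [Fact p.Prime]
    (hrank : ((G.lapMatrix ℤ).map (Int.cast : ℤ → ZMod p)).rank + d + 1 = Fintype.card V) :
    ∃ φ : criticalGroup G →+ (Fin d → ZMod p), Function.Surjective φ ∧
      ∀ x, φ x = 0 → ∃ y, x = p • y := by
  set L := G.lapMatrix ℤ
  let T : Submodule (ZMod p) (V → ZMod p) :=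
    LinearMap.range (L.map (Int.cast : ℤ → ZMod p)).mulVecLin
  let red : (V → ℤ) →+ (V → ZMod p) := (Int.castAddHom (ZMod p)).compLeft V
  have hred (x : V → ℤ) : red (L *ᵥ x) = L.map (Int.cast : ℤ → ZMod p) *ᵥ red x := by
    ext i
    simp [red, Matrix.mulVec, dotProduct]
  have hlift (y : V → ZMod p) : ∃ x, red x = y :=
    ⟨fun i => ((y i).val : ℤ), by ext i; simp [red]⟩
  let s : (V → ZMod p) →ₗ[ZMod p] ZMod p := ∑ i, LinearMap.proj i
  have hs (y : V → ZMod p) : s y = ∑ i, y i := by simp [s]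
  have hsred (x : V → ℤ) : s (red x) = ((∑ i, x i : ℤ) : ZMod p) := by
    simp [hs, red]
  have hTs : T ≤ LinearMap.ker s := by
    rintro _ ⟨y, rfl⟩
    obtain ⟨x, rfl⟩ := hlift y
    rw [Matrix.mulVecLin_apply, ← hred, LinearMap.mem_ker, hsred, G.sum_lapMatrix_mulVec_s14,
      Int.cast_zero]
  let σ : ((V → ZMod p) ⧸ T) →ₗ[ZMod p] ZMod p := T.liftQ s hTs
  have hσ : LinearMap.range σ = ⊤ := by
    rw [LinearMap.range_eq_top]
    intro t
    exact ⟨T.mkQ (Pi.single (Classical.arbitrary V) t), by simp [σ, hs]⟩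
  have hdim : Module.finrank (ZMod p) (LinearMap.ker σ) = d := by
    have h₁ := σ.finrank_range_add_finrank_ker
    have h₂ := T.finrank_quotient_add_finrank
    rw [hσ, finrank_top, Module.finrank_self] at h₁
    rw [Module.finrank_fintype_fun_eq_card] at h₂
    change Module.finrank (ZMod p) T + d + 1 = _ at hrank
    lia
  let e : LinearMap.ker σ ≃ₗ[ZMod p] (Fin d → ZMod p) :=
    LinearEquiv.ofFinrankEq _ _ (by rw [hdim, Module.finrank_fin_fun])
  let f : ((V → ℤ) ⧸ LinearMap.range (Matrix.toLin' L)) →ₗ[ℤ] ((V → ZMod p) ⧸ T) :=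
    (LinearMap.range (Matrix.toLin' L)).liftQ
      (T.mkQ.toAddMonoidHom.comp red).toIntLinearMap (by
        rintro _ ⟨x, rfl⟩
        rw [LinearMap.mem_ker, Matrix.toLin'_apply]
        change T.mkQ (red (L *ᵥ x)) = 0
        rw [hred, Submodule.mkQ_apply, Submodule.Quotient.mk_eq_zero]
        exact ⟨red x, rfl⟩)
  have hf (x : V → ℤ) : f (Submodule.Quotient.mk x) = T.mkQ (red x) := rfl
  have hfker (x : criticalGroup G) : f x ∈ LinearMap.ker σ := by
    obtain ⟨x, hx⟩ := x
    obtain ⟨x, rfl⟩ := Submodule.Quotient.mk_surjective _ x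
    rw [LinearMap.mem_ker, hf]
    change s (red x) = 0
    rw [hsred, sum_eq_zero_of_mem_criticalGroup G hx, Int.cast_zero]
  let ψ : criticalGroup G →+ LinearMap.ker σ :=
    (f.toAddMonoidHom.comp (criticalGroup G).subtype.toAddMonoidHom).codRestrict _ hfker
  refine ⟨e.toAddEquiv.toAddMonoidHom.comp ψ, e.surjective.comp ?_, ?_⟩
  · rintro ⟨y, hy⟩
    obtain ⟨y, rfl⟩ := T.mkQ_surjective y
    obtain ⟨x, rfl⟩ := hlift y
    have hy' : s (red x) = 0 := hy
    rw [hsred, ZMod.intCast_zmod_eq_zero_iff_dvd] at hy'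
    let x' : V → ℤ := x - Pi.single (Classical.arbitrary V) (∑ i, x i)
    have hx' : ∑ i, x' i = 0 := by simp [x']
    refine ⟨⟨Submodule.Quotient.mk x', hmem x' hx'⟩, Subtype.ext ?_⟩
    change T.mkQ (red x') = T.mkQ (red x)
    congr 1
    ext i
    have : ((∑ i, x i : ℤ) : ZMod p) = 0 := (ZMod.intCast_zmod_eq_zero_iff_dvd _ _).2 hy'
    by_cases hi : i = Classical.arbitrary V
    · subst hi
      simp [red, x', -Int.cast_sum, this]
    · simp [red, x', hi]
  · rintro ⟨x, hx⟩ hφ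
    obtain ⟨x, rfl⟩ := Submodule.Quotient.mk_surjective _ x
    have h : T.mkQ (red x) = 0 := congrArg Subtype.val (e.map_eq_zero_iff.1 hφ)
    rw [Submodule.mkQ_apply, Submodule.Quotient.mk_eq_zero] at h
    obtain ⟨w, hw⟩ := h
    obtain ⟨w, rfl⟩ := hlift w
    rw [Matrix.mulVecLin_apply, ← hred] at hw
    have hdvd (i : V) : (p : ℤ) ∣ x i - (L *ᵥ w) i := by
      rw [← ZMod.intCast_zmod_eq_zero_iff_dvd, Int.cast_sub, sub_eq_zero]
      exact (congrFun hw i).symm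
    choose z hz using hdvd
    have hsum : ∑ i, z i = 0 := by
      have : (p : ℤ) * ∑ i, z i = 0 := by
        rw [Finset.mul_sum, ← Finset.sum_congr rfl fun i _ => hz i, Finset.sum_sub_distrib,
          sum_eq_zero_of_mem_criticalGroup G hx, G.sum_lapMatrix_mulVec_s14, sub_zero]
      exact (mul_eq_zero.1 this).resolve_left (by exact_mod_cast (Fact.out : p.Prime).ne_zero)
    refine ⟨⟨Submodule.Quotient.mk z, hmem z hsum⟩, Subtype.ext ?_⟩
    change Submodule.Quotient.mk x = Submodule.Quotient.mk (p • z)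
    rw [Submodule.Quotient.eq]
    refine ⟨w, ?_⟩
    rw [Matrix.toLin'_apply]
    ext i
    change (L *ᵥ w) i = x i - p • z i
    rw [nsmul_eq_mul, ← hz i, sub_sub_cancel]

end CriticalGroup

theorem Nat.fact_prime_eleven : Fact (Nat.Prime 11) := ⟨by norm_num⟩

section StronglyRegular

attribute [local instance] Nat.fact_prime_eleven

variable {V : Type*} [Fintype V] [DecidableEq V] {G : SimpleGraph V} [DecidableRel G.Adj]

namespace SimpleGraph.IsSRGWith

theorem lapMatrix_eq {n k l m : ℕ} (h : G.IsSRGWith n k l m) :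
    G.lapMatrix ℤ = (k : ℤ) • 1 - G.adjMatrix ℤ := by
  ext i j
  rw [Matrix.sub_apply, Matrix.smul_apply, Matrix.one_apply]
  by_cases hij : i = j <;> simp [lapMatrix, degMatrix, hij, h.regular.degree_eq]

theorem lapMatrix_mul_self_s14 (h : G.IsSRGWith 99 14 1 2) :
    G.lapMatrix ℤ * G.lapMatrix ℤ =
      (29 : ℤ) • G.lapMatrix ℤ - (198 : ℤ) • 1 + (2 : ℤ) • Matrix.of fun _ _ => 1 := by
  have hA := h.matrix_eq (α := ℤ)
  rw [sq] at hA
  rw [h.lapMatrix_eq]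
  simp only [sub_mul, mul_sub, smul_mul_assoc, mul_smul_comm, one_mul, mul_one, hA]
  ext i j
  simp only [Matrix.add_apply, Matrix.sub_apply, Matrix.smul_apply, Matrix.one_apply,
    Matrix.of_apply, adjMatrix_apply, compl_adj]
  by_cases hij : i = j
  · simp [hij]
  · by_cases hadj : G.Adj i j <;> simp [hij, hadj]

theorem trace_lapMatrix (h : G.IsSRGWith 99 14 1 2) : (G.lapMatrix ℤ).trace = 1386 := by
  rw [h.lapMatrix_eq, Matrix.trace_sub, Matrix.trace_smul, Matrix.trace_one, trace_adjMatrix,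
    h.card]
  norm_num

theorem lapMatrix_mul_lapMatrix_mul_self (h : G.IsSRGWith 99 14 1 2) :
    G.lapMatrix ℤ * (G.lapMatrix ℤ * G.lapMatrix ℤ) =
      (29 : ℤ) • (G.lapMatrix ℤ * G.lapMatrix ℤ) - (198 : ℤ) • G.lapMatrix ℤ := by
  have hone : G.lapMatrix ℤ * (Matrix.of fun _ _ => 1) = 0 := by
    ext i j
    simpa [Matrix.mul_apply, Matrix.mulVec, dotProduct] using
      congrFun (G.lapMatrix_mulVec_const_eq_zero (R := ℤ)) i
  conv_lhs => rw [h.lapMatrix_mul_self_s14]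
  simp only [mul_add, mul_sub, mul_smul_comm, mul_one, hone, smul_zero, add_zero]

theorem trace_lapMatrix_mul_self (h : G.IsSRGWith 99 14 1 2) :
    (G.lapMatrix ℤ * G.lapMatrix ℤ).trace = 20790 := by
  rw [h.lapMatrix_mul_self_s14, Matrix.trace_add, Matrix.trace_sub, Matrix.trace_smul,
    Matrix.trace_smul, Matrix.trace_smul, Matrix.trace_one, h.trace_lapMatrix, h.card]
  simp [Matrix.trace, h.card]

/-- For `c` a nonzero Laplacian eigenvalue, `29 - c` is the other one, and `L (L - (29 - c))` is a
multiple of the projection onto the eigenspace of `c`. -/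
theorem rank_map_lapMatrix_mul_self_sub (h : G.IsSRGWith 99 14 1 2) (p : ℕ) [Fact p.Prime]
    {c : ℤ} {r : ℕ} (hc : c ^ 2 - 29 * c + 198 = 0) (hr : 20790 - (29 - c) * 1386 =
      c * (2 * c - 29) * r) (hp : ((c * (2 * c - 29) : ℤ) : ZMod p) ≠ 0) :
    ((G.lapMatrix ℤ * G.lapMatrix ℤ - (29 - c) • G.lapMatrix ℤ).map
      (Int.cast : ℤ → ZMod p)).rank = r := by
  have h₃ := h.lapMatrix_mul_lapMatrix_mul_self
  apply Matrix.rank_map_intCast_zmod_of_mul_self_eq_smul p hp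
  · simp only [sub_mul, mul_sub, smul_mul_assoc, mul_smul_comm, mul_assoc, h₃]
    match_scalars
    · linear_combination -hc
    · linear_combination (29 - 2 * c) * hc
  · rw [Matrix.trace_sub, Matrix.trace_smul, h.trace_lapMatrix, h.trace_lapMatrix_mul_self,
      smul_eq_mul, hr]

theorem map_lapMatrix_mul_self_zmod (h : G.IsSRGWith 99 14 1 2) (p : ℕ) :
    (G.lapMatrix ℤ).map (Int.cast : ℤ → ZMod p) * (G.lapMatrix ℤ).map (Int.cast : ℤ → ZMod p) =
      (29 : ZMod p) • (G.lapMatrix ℤ).map (Int.cast : ℤ → ZMod p) - (198 : ZMod p) • 1 +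
        (2 : ZMod p) • Matrix.of fun _ _ => 1 := by
  have := congrArg (Int.castRingHom (ZMod p)).mapMatrix h.lapMatrix_mul_self_s14
  rw [map_mul] at this
  refine this.trans ?_
  ext i j
  simp only [RingHom.mapMatrix_apply, Matrix.map_apply, Matrix.add_apply, Matrix.sub_apply,
    Matrix.smul_apply, Matrix.one_apply, Matrix.of_apply]
  by_cases hij : i = j <;> simp [hij]

theorem map_lapMatrix_mulVec_one (p : ℕ) :
    (G.lapMatrix ℤ).map (Int.cast : ℤ → ZMod p) *ᵥ 1 = 0 := by
  ext i
  have := congrFun (G.lapMatrix_mulVec_const_eq_zero (R := ℤ)) i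
  simpa [Matrix.mulVec, dotProduct] using congrArg (Int.cast : ℤ → ZMod p) this

theorem rank_map_lapMatrix_mul_map_lapMatrix_sub (h : G.IsSRGWith 99 14 1 2) (p : ℕ)
    [Fact p.Prime] {c : ℤ} {r : ℕ} (hc : c ^ 2 - 29 * c + 198 = 0)
    (hr : 20790 - (29 - c) * 1386 = c * (2 * c - 29) * r)
    (hp : ((c * (2 * c - 29) : ℤ) : ZMod p) ≠ 0) :
    ((G.lapMatrix ℤ).map (Int.cast : ℤ → ZMod p) * (G.lapMatrix ℤ).map (Int.cast : ℤ → ZMod p) -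
      ((29 - c : ℤ) : ZMod p) • (G.lapMatrix ℤ).map (Int.cast : ℤ → ZMod p)).rank = r := by
  rw [← h.rank_map_lapMatrix_mul_self_sub p hc hr hp]
  congr 1
  ext i j
  simp [Matrix.mul_apply, -zsmul_eq_mul]

theorem rank_lapMatrix_zmod_two (h : G.IsSRGWith 99 14 1 2) :
    ((G.lapMatrix ℤ).map (Int.cast : ℤ → ZMod 2)).rank = 54 := by
  have hr := h.rank_map_lapMatrix_mul_map_lapMatrix_sub 2 (c := 11) (r := 54) (by norm_num)
    (by norm_num) (by decide)
  rwa [h.map_lapMatrix_mul_self_zmod, show ((29 - 11 : ℤ) : ZMod 2) = 0 from by decide,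
    show (29 : ZMod 2) = 1 from by decide, show (198 : ZMod 2) = 0 from by decide,
    show (2 : ZMod 2) = 0 from by decide, one_smul, zero_smul, zero_smul, zero_smul, sub_zero,
    sub_zero, add_zero] at hr

theorem rank_lapMatrix_zmod_three (h : G.IsSRGWith 99 14 1 2) :
    ((G.lapMatrix ℤ).map (Int.cast : ℤ → ZMod 3)).rank = 55 := by
  have : Nonempty V := Fintype.card_pos_iff.mp (by rw [h.card]; norm_num)
  have hr := h.rank_map_lapMatrix_mul_map_lapMatrix_sub 3 (c := 11) (r := 54) (by norm_num)
    (by norm_num) (by decide)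
  rw [show ((29 - 11 : ℤ) : ZMod 3) = 0 from by decide, zero_smul, sub_zero] at hr
  rw [Matrix.rank_eq_rank_mul_self_add_one (a := -1) (b := 2) (by decide) _
    (map_lapMatrix_mulVec_one 3), hr]
  rw [h.map_lapMatrix_mul_self_zmod]
  match_scalars <;> decide

theorem rank_lapMatrix_zmod_eleven (h : G.IsSRGWith 99 14 1 2) :
    ((G.lapMatrix ℤ).map (Int.cast : ℤ → ZMod 11)).rank = 45 := by
  have : Nonempty V := Fintype.card_pos_iff.mp (by rw [h.card]; norm_num)
  have hr := h.rank_map_lapMatrix_mul_map_lapMatrix_sub 11 (c := 18) (r := 44) (by norm_num)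
    (by norm_num) (by decide)
  rw [show ((29 - 18 : ℤ) : ZMod 11) = 0 from by decide, zero_smul, sub_zero] at hr
  rw [Matrix.rank_eq_rank_mul_self_add_one (a := 8) (b := 6) (by decide) _
    (map_lapMatrix_mulVec_one 11), hr]
  rw [h.map_lapMatrix_mul_self_zmod]
  match_scalars <;> decide

theorem lapMatrix_mulVec_lapMatrix_mulVec (h : G.IsSRGWith 99 14 1 2) (x : V → ℤ) :
    G.lapMatrix ℤ *ᵥ (G.lapMatrix ℤ *ᵥ x) =
      (29 : ℤ) • (G.lapMatrix ℤ *ᵥ x) - (198 : ℤ) • x + fun _ => 2 * ∑ i, x i := by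
  rw [Matrix.mulVec_mulVec, h.lapMatrix_mul_self_s14, Matrix.add_mulVec, Matrix.sub_mulVec,
    Matrix.smul_mulVec, Matrix.smul_mulVec, Matrix.smul_mulVec, Matrix.one_mulVec]
  congr 1
  ext i
  simp [Matrix.mulVec, dotProduct]

theorem smul_eq_lapMatrix_mulVec (h : G.IsSRGWith 99 14 1 2) {x : V → ℤ} (hx : ∑ i, x i = 0) :
    (198 : ℤ) • x = G.lapMatrix ℤ *ᵥ ((29 : ℤ) • x - G.lapMatrix ℤ *ᵥ x) := by
  rw [Matrix.mulVec_sub, Matrix.mulVec_smul, h.lapMatrix_mulVec_lapMatrix_mulVec, hx]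
  ext i
  simp

/-- Divisibility by `3` of the elements killed by `3` in the cokernel of the Laplacian. -/
theorem exists_eq_lapMatrix_mulVec_add_smul (h : G.IsSRGWith 99 14 1 2) {x y : V → ℤ}
    (hxy : (3 : ℤ) • x = G.lapMatrix ℤ *ᵥ y) :
    ∃ w z : V → ℤ, x = G.lapMatrix ℤ *ᵥ w + (3 : ℤ) • z := by
  obtain ⟨v⟩ : Nonempty V := Fintype.card_pos_iff.mp (by rw [h.card]; norm_num)
  have hy := h.lapMatrix_mulVec_lapMatrix_mulVec y
  have hv := h.lapMatrix_mulVec_lapMatrix_mulVec (Pi.single v 1)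
  rw [← hxy, Matrix.mulVec_smul] at hy
  obtain ⟨t, ht⟩ : (3 : ℤ) ∣ ∑ i, y i := by
    have := congrFun hy v
    simp only [Pi.smul_apply, Pi.add_apply, Pi.sub_apply, smul_eq_mul] at this
    omega
  refine ⟨t • (G.lapMatrix ℤ *ᵥ Pi.single v 1 - (29 : ℤ) • Pi.single v 1) - x,
    (10 : ℤ) • x - (22 : ℤ) • y + (66 * t) • Pi.single v 1, ?_⟩
  rw [Matrix.mulVec_sub, Matrix.mulVec_smul, Matrix.mulVec_sub, Matrix.mulVec_smul, hv]
  ext i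
  have := congrFun hy i
  simp only [Pi.smul_apply, Pi.add_apply, Pi.sub_apply, smul_eq_mul, ht] at this ⊢
  simp only [Finset.sum_pi_single', Finset.mem_univ, if_true]
  linarith

end SimpleGraph.IsSRGWith

end StronglyRegular

/-- If `Γ` is a connected strongly regular graph with parameters
`(99, 14, 1, 2)` (Conway's 99-graph), then
`K(Γ) ≅ (ℤ/11)^53 ⊕ (ℤ/2)^44 ⊕ (ℤ/9)^43`. -/
theorem criticalGroup_srg_99_14_1_2 {V : Type*} [Fintype V] [DecidableEq V]
    (G : SimpleGraph V) [DecidableRel G.Adj]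
    (hsrg : G.IsSRGWith 99 14 1 2) (hconn : G.Connected) :
    Nonempty (↥(criticalGroup G) ≃+
      ((Fin 53 → ZMod 11) × (Fin 44 → ZMod 2) × (Fin 43 → ZMod 9))) := by
  have : Nonempty V := hconn.nonempty
  have := Nat.fact_prime_eleven
  have hmem (x : V → ℤ) (hx : ∑ i, x i = 0) : Submodule.Quotient.mk x ∈ criticalGroup G := by
    refine (Submodule.mem_torsion_iff _).mpr ⟨⟨198, by simp⟩, ?_⟩
    exact (Submodule.Quotient.mk_eq_zero _).mpr ⟨_, (hsrg.smul_eq_lapMatrix_mulVec hx).symm⟩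
  obtain ⟨φ₁₁, h₁₁, hk₁₁⟩ := exists_criticalGroup_reduction G hmem 11 53
    (by rw [hsrg.rank_lapMatrix_zmod_eleven, hsrg.card])
  obtain ⟨φ₂, h₂, hk₂⟩ := exists_criticalGroup_reduction G hmem 2 44
    (by rw [hsrg.rank_lapMatrix_zmod_two, hsrg.card])
  obtain ⟨φ₃, h₃, hk₃⟩ := exists_criticalGroup_reduction G hmem 3 43
    (by rw [hsrg.rank_lapMatrix_zmod_three, hsrg.card])
  refine nonempty_addEquiv_of_reductions ?_ φ₁₁ φ₂ φ₃ h₁₁ h₂ h₃ hk₁₁ hk₂ hk₃ ?_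
  · rintro ⟨q, hq⟩
    obtain ⟨x, rfl⟩ := Submodule.Quotient.mk_surjective _ q
    have hx := sum_eq_zero_of_mem_criticalGroup G hq
    refine Subtype.ext ((Submodule.Quotient.mk_eq_zero (x := 198 • x) _).mpr ⟨_,
      (hsrg.smul_eq_lapMatrix_mulVec hx).symm.trans (natCast_zsmul x 198)⟩)
  · rintro ⟨q, hq⟩ hq₃
    obtain ⟨x, rfl⟩ := Submodule.Quotient.mk_surjective _ q
    have hx := sum_eq_zero_of_mem_criticalGroup G hq
    obtain ⟨y, hy⟩ := (Submodule.Quotient.mk_eq_zero (x := 3 • x) _).mp (Subtype.ext_iff.mp hq₃)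
    obtain ⟨w, z, hwz⟩ := hsrg.exists_eq_lapMatrix_mulVec_add_smul (x := x) (y := y)
      ((natCast_zsmul x 3).trans hy.symm)
    have hz : ∑ i, z i = 0 := by
      rw [hwz] at hx
      simpa [Finset.sum_add_distrib, sum_lapMatrix_mulVec_s14, ← Finset.mul_sum] using hx
    refine ⟨⟨_, hmem z hz⟩, Subtype.ext ((Submodule.Quotient.eq (y := 3 • z) _).mpr ⟨w, ?_⟩)⟩
    rw [Matrix.toLin'_apply, eq_sub_iff_add_eq, hwz]
    congr 1
end

section
/- Let Γ be the 4×4 rook graph, i.e., the box (Cartesian) product K₄ □ K₄ of two complete graphs on 4 vertices, whose vertices are pairs (i,j) with i, j ∈ {1,2,3,4} and where (i,j) and (i',j') are adjacent exactly when i = i' and j ≠ j', or j = j' and i ≠ i'. Then the critical group of Γ satisfies K(Γ) ≅ (Z/8Z)^5 ⊕ (Z/32Z)^4. -/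
open SimpleGraph

/-- The `4 × 4` rook graph: the box (Cartesian) product `K₄ □ K₄` of two complete graphs on
four vertices.  Its vertices are pairs `(i, j)` with `i, j : Fin 4`, and `(i, j)` is adjacent
to `(i', j')` exactly when `i = i'` and `j ≠ j'`, or `j = j'` and `i ≠ i'`. -/
def rookGraph : SimpleGraph (Fin 4 × Fin 4) :=
  (⊤ : SimpleGraph (Fin 4)) □ (⊤ : SimpleGraph (Fin 4))

instance : DecidableRel rookGraph.Adj := fun a b =>
  decidable_of_iff ((a.1 ≠ b.1 ∧ a.2 = b.2) ∨ (a.2 ≠ b.2 ∧ a.1 = b.1))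
    (by rw [rookGraph, SimpleGraph.boxProd_adj]; rfl)

/-- The torsion of a quotient `M ⧸ N` of abelian groups is isomorphic to a finite group `T` as soon
as `N` is the common kernel of maps `φ : M → T` and `ψ : M → ℤ` such that `φ` is already surjective
on the kernel of `ψ`. -/
theorem nonempty_torsion_quotient_addEquiv {M T : Type*}
    [AddCommGroup M] [AddCommGroup T] [Finite T] (N : Submodule ℤ M) (φ : M →ₗ[ℤ] T) (ψ : M →ₗ[ℤ] ℤ)
    (hN : N = LinearMap.ker φ ⊓ LinearMap.ker ψ)
    (hsurj : ∀ t, ∃ x, ψ x = 0 ∧ φ x = t) :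
    Nonempty (↥(Submodule.torsion ℤ (M ⧸ N)) ≃+ T) := by
  have hφ : N ≤ LinearMap.ker φ := hN ▸ inf_le_left
  have hψ : N ≤ LinearMap.ker ψ := hN ▸ inf_le_right
  let f := (N.liftQ φ hφ).toAddMonoidHom.comp (Submodule.torsion ℤ (M ⧸ N)).subtype.toAddMonoidHom
  refine ⟨AddEquiv.ofBijective f ⟨?_, fun t => ?_⟩⟩
  · rw [injective_iff_map_eq_zero]
    rintro ⟨q, hq⟩ h
    obtain ⟨x, rfl⟩ := N.mkQ_surjective q
    obtain ⟨⟨a, ha⟩, hax⟩ := hq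
    have hx : φ x = 0 := h
    have hax' : a • x ∈ N := by
      rw [← Submodule.Quotient.mk_eq_zero]
      exact hax
    have hψx : a * ψ x = 0 := by simpa using hψ hax'
    have hψx' : ψ x = 0 := (mul_eq_zero.mp hψx).resolve_left (nonZeroDivisors.ne_zero ha)
    have hxN : x ∈ N := by
      rw [hN]
      exact ⟨hx, hψx'⟩
    exact Subtype.ext ((Submodule.Quotient.mk_eq_zero N).mpr hxN)
  · obtain ⟨x, hψx, rfl⟩ := hsurj t
    have hxN : (Nat.card T : ℤ) • x ∈ N := by
      rw [hN]
      refine ⟨?_, by simp [hψx]⟩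
      rw [SetLike.mem_coe, LinearMap.mem_ker, map_smul, Nat.cast_smul_eq_nsmul, card_nsmul_eq_zero']
    refine ⟨⟨N.mkQ x, ⟨⟨(Nat.card T : ℤ), mem_nonZeroDivisors_of_ne_zero ?_⟩, ?_⟩⟩, rfl⟩
    · exact_mod_cast Nat.card_pos.ne'
    · exact (Submodule.Quotient.mk_eq_zero N).mpr hxN

theorem toLin'_lapMatrix_rookGraph_apply (v : Fin 4 × Fin 4 → ℤ) (i j : Fin 4) :
    Matrix.toLin' (rookGraph.lapMatrix ℤ) v (i, j) =
      8 * v (i, j) - ∑ k, v (i, k) - ∑ k, v (k, j) := by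
  have hL : ∀ a b : Fin 4 × Fin 4, rookGraph.lapMatrix ℤ a b =
      (if a = b then 8 else 0) - (if a.1 = b.1 then 1 else 0) - (if a.2 = b.2 then 1 else 0) := by
    have hdeg : ∀ a, rookGraph.degree a = 6 := by decide
    have hadj : ∀ a b, rookGraph.Adj a b ↔ (a.1 ≠ b.1 ∧ a.2 = b.2) ∨ (a.2 ≠ b.2 ∧ a.1 = b.1) :=
      fun _ _ => boxProd_adj
    rintro ⟨a, a'⟩ ⟨b, b'⟩
    simp only [lapMatrix, degMatrix, Matrix.sub_apply, Matrix.diagonal_apply, hdeg,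
      adjMatrix_apply, hadj, Prod.mk.injEq]
    by_cases h : a = b <;> by_cases h' : a' = b' <;> simp [h, h']
  simp only [Matrix.toLin'_apply, Matrix.mulVec, dotProduct, hL, Fintype.sum_prod_type, sub_mul,
    Finset.sum_sub_distrib, Prod.mk.injEq]
  simp [ite_and, Finset.sum_ite_irrel]

/-- Linear forms on `ℤ^(4 × 4)` that are divisible by `8` on the image of the Laplacian. -/
def rookForms8 (x : Fin 4 × Fin 4 → ℤ) : Fin 5 → ℤ :=
  ![x (1, 1) - x (1, 0) - x (0, 1) + x (0, 0),
    x (1, 2) - x (1, 0) - x (0, 2) + x (0, 0),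
    x (2, 1) - x (2, 0) - x (0, 1) + x (0, 0),
    x (2, 2) - x (2, 0) - x (0, 2) + x (0, 0),
    x (1, 0) + x (2, 0) + x (3, 0) - x (0, 1) - x (0, 2) - x (0, 3) - 4 * x (0, 0)]

/-- Linear forms on `ℤ^(4 × 4)` that are divisible by `32` on the image of the Laplacian. -/
def rookForms32 (x : Fin 4 × Fin 4 → ℤ) : Fin 4 → ℤ :=
  ![∑ j, (x (1, j) - x (0, j)) + 4 * (x (1, 0) - x (0, 0)),
    ∑ j, (x (2, j) - x (0, j)) + 4 * (x (2, 0) - x (0, 0)),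
    ∑ i, (x (i, 1) - x (i, 0)) + 4 * (x (0, 1) - x (0, 0)),
    ∑ i, (x (i, 2) - x (i, 0)) + 4 * (x (0, 2) - x (0, 0))]

theorem rookForms8_add (x y : Fin 4 × Fin 4 → ℤ) :
    rookForms8 (x + y) = rookForms8 x + rookForms8 y := by
  ext i
  fin_cases i <;> simp [rookForms8] <;> ring

theorem rookForms32_add (x y : Fin 4 × Fin 4 → ℤ) :
    rookForms32 (x + y) = rookForms32 x + rookForms32 y := by
  ext i
  fin_cases i <;> simp [rookForms32, Fin.sum_univ_four] <;> ring

/-- The map `ℤ^(4 × 4) → (ℤ/8)^5 ⊕ (ℤ/32)^4` given by reducing the forms `rookForms8` and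
`rookForms32`. -/
def rookMap : (Fin 4 × Fin 4 → ℤ) →ₗ[ℤ] (Fin 5 → ZMod 8) × (Fin 4 → ZMod 32) :=
  (AddMonoidHom.mk' (fun x => (fun i => (rookForms8 x i : ZMod 8),
    fun i => (rookForms32 x i : ZMod 32))) fun x y => by
      ext <;> simp [rookForms8_add, rookForms32_add]).toIntLinearMap

theorem rookMap_apply (x : Fin 4 × Fin 4 → ℤ) :
    rookMap x = (fun i => (rookForms8 x i : ZMod 8), fun i => (rookForms32 x i : ZMod 32)) :=
  rfl

theorem rookMap_eq_zero_iff (x : Fin 4 × Fin 4 → ℤ) :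
    rookMap x = 0 ↔ (∀ i, 8 ∣ rookForms8 x i) ∧ ∀ i, 32 ∣ rookForms32 x i := by
  simp only [rookMap_apply, Prod.ext_iff, funext_iff, Prod.fst_zero, Prod.snd_zero, Pi.zero_apply,
    ZMod.intCast_zmod_eq_zero_iff_dvd]
  rfl

/-- The sum of all entries, as a linear map. -/
def rookSum : (Fin 4 × Fin 4 → ℤ) →ₗ[ℤ] ℤ :=
  ∑ a, LinearMap.proj a

theorem rookSum_apply (x : Fin 4 × Fin 4 → ℤ) : rookSum x = ∑ i, ∑ j, x (i, j) := by
  simp [rookSum, Fintype.sum_prod_type]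

theorem exists_rookSum_eq_zero_and_rookMap_eq (t : (Fin 5 → ZMod 8) × (Fin 4 → ZMod 32)) :
    ∃ x, rookSum x = 0 ∧ rookMap x = t := by
  obtain ⟨s, t⟩ := t
  choose a ha using fun i => ZMod.intCast_surjective (s i)
  choose b hb using fun i => ZMod.intCast_surjective (t i)
  let y : Matrix (Fin 4) (Fin 4) ℤ :=
    !![0, 0, 0, 0;
      0, a 0, a 1, b 0 - a 0 - a 1;
      0, a 2, a 3, b 1 - a 2 - a 3;
      a 4, a 4 + b 2 - a 0 - a 2, a 4 + b 3 - a 1 - a 3,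
        a 0 + a 1 + a 2 + a 3 - 3 * a 4 - b 0 - b 1 - b 2 - b 3]
  have h8 : rookForms8 (fun p => y p.1 p.2) = a := by
    ext i
    fin_cases i <;> simp [rookForms8, y]
  have h32 : rookForms32 (fun p => y p.1 p.2) = b := by
    ext i
    fin_cases i <;> simp [rookForms32, y, Fin.sum_univ_four]
  refine ⟨fun p => y p.1 p.2, ?_, ?_⟩
  · simp [rookSum_apply, Fin.sum_univ_four, y]
    ring
  · ext i <;> simp [rookMap_apply, h8, h32, ha, hb]

theorem rookMap_toLin'_lapMatrix (v : Fin 4 × Fin 4 → ℤ) :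
    rookMap (Matrix.toLin' (rookGraph.lapMatrix ℤ) v) = 0 := by
  rw [rookMap_eq_zero_iff]
  constructor <;> intro i <;> fin_cases i <;>
    simp only [rookForms8, rookForms32, toLin'_lapMatrix_rookGraph_apply, Fin.sum_univ_four] <;>
    simp <;> omega

theorem rookSum_toLin'_lapMatrix (v : Fin 4 × Fin 4 → ℤ) :
    rookSum (Matrix.toLin' (rookGraph.lapMatrix ℤ) v) = 0 := by
  simp only [rookSum_apply, toLin'_lapMatrix_rookGraph_apply, Fin.sum_univ_four]
  ring

theorem mem_range_lapMatrix_rookGraph {x : Fin 4 × Fin 4 → ℤ} (hx : rookMap x = 0)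
    (hs : rookSum x = 0) : x ∈ LinearMap.range (Matrix.toLin' (rookGraph.lapMatrix ℤ)) := by
  rw [rookMap_eq_zero_iff] at hx
  choose y hy using hx.1
  choose F hF using hx.2
  have hy0 := hy 0
  have hy1 := hy 1
  have hy2 := hy 2
  have hy3 := hy 3
  have hy4 := hy 4
  have hF0 := hF 0
  have hF1 := hF 1
  have hF2 := hF 2
  have hF3 := hF 3
  simp only [rookSum_apply, Fin.sum_univ_four] at hs
  simp [rookForms8] at hy0 hy1 hy2 hy3 hy4
  simp [rookForms32, Fin.sum_univ_four] at hF0 hF1 hF2 hF3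
  let α : Fin 4 → ℤ := ![0, F 0, F 1, y 4 - F 0 - F 1]
  let β : Fin 4 → ℤ := ![0, F 2, F 3, -x (0, 0) - y 4 - F 2 - F 3]
  let r : Fin 4 → ℤ := fun i => 4 * α i - (x (i, 0) - x (0, 0))
  let c : Fin 4 → ℤ := fun j => 4 * β j - (x (0, j) - x (0, 0))
  let w : Matrix (Fin 4) (Fin 4) ℤ :=
    !![0, 0, 0, 0;
      0, y 0, y 1, r 1 - y 0 - y 1;
      0, y 2, y 3, r 2 - y 2 - y 3;
      0, c 1 - y 0 - y 2, c 2 - y 1 - y 3,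
        r 3 - (c 1 - y 0 - y 2) - (c 2 - y 1 - y 3)]
  refine ⟨fun p => w p.1 p.2 + α p.1 + β p.2, ?_⟩
  ext ⟨i, j⟩
  rw [toLin'_lapMatrix_rookGraph_apply]
  fin_cases i <;> fin_cases j <;> simp [w, r, c, α, β, Fin.sum_univ_four] <;> linarith

theorem range_lapMatrix_rookGraph :
    LinearMap.range (Matrix.toLin' (rookGraph.lapMatrix ℤ)) =
      LinearMap.ker rookMap ⊓ LinearMap.ker rookSum := by
  apply le_antisymm
  · rintro _ ⟨v, rfl⟩
    exact ⟨rookMap_toLin'_lapMatrix v, rookSum_toLin'_lapMatrix v⟩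
  · rintro x ⟨hx, hs⟩
    exact mem_range_lapMatrix_rookGraph hx hs

/-- The critical group of the `4 × 4` rook graph `K₄ □ K₄` is
`(ℤ/8)^5 ⊕ (ℤ/32)^4`. -/
theorem criticalGroup_rookGraph :
    Nonempty (↥(criticalGroup rookGraph) ≃+
      ((Fin 5 → ZMod 8) × (Fin 4 → ZMod 32))) :=
  nonempty_torsion_quotient_addEquiv _ rookMap rookSum range_lapMatrix_rookGraph
    exists_rookSum_eq_zero_and_rookMap_eq
end
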